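/- arXiv:1312.1986 — 2 statements merged into one kernel-verified Lean document; each statement's English description precedes it below -/
import Mathlib

section
/- Fix states i ≠ j such that E_x[T_j] < ∞ for every x ∈ Σ, and a positive integer θ. Writing Ê = E_i[min(T_i, θ)] and E_i[F̂_j] = E_i[Σ_{s=1}^{min(T_i,θ)} 1{X_s = j}], one has E_i[F̂_j]/Ê − π_j = (π_j/Ê) · Σ_{q ∈ Σ, q ≠ i} P_i(X_θ = q and T_i > θ) · (E_q[T_j] − E_i[T_j]). (This is the identity E_i[F̂_j^{(t)}]/E_i[T̂_i^{(t)}] − π_j = (P_i(T_i > θ)/E_i[T̂_i^{(t)}])·Σ_q P_i(X_θ = q | T_i > θ)(Z_ij − Z_qj) of the paper, with Z_ij − Z_qj rewritten via Z_ij − Z_qj = π_j(E_q[T_j] − E_i[T_j]).) -/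
open MeasureTheory ProbabilityTheory Finset Set
open scoped ENNReal NNReal Classical

namespace LocalStationary

noncomputable section

/-- First return time (≥ 1) of a trajectory `f` to the state `i`, valued in `ℕ∞`
(it equals `⊤` if the trajectory never returns to `i`). -/
def hit {S : Type*} (i : S) (f : ℕ → S) : ℕ∞ :=
  sInf {n : ℕ∞ | ∃ m : ℕ, n = m ∧ 1 ≤ m ∧ f m = i}

/-- Truncated return time `min(T_i, θ)` as a natural number. -/
def truncHit {S : Type*} (i : S) (θ : ℕ) (f : ℕ → S) : ℕ :=
  (min (hit i f) (θ : ℕ∞)).toNat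

/-- Number of visits to `j` among the first `min(T_i, θ)` steps of the trajectory. -/
def visits {S : Type*} (i j : S) (θ : ℕ) (f : ℕ → S) : ℕ :=
  ((Finset.Icc 1 (truncHit i θ f)).filter fun s => f s = j).card

/-- A discrete-time time-homogeneous Markov chain on a state space `S`, described by
the laws `μ x` of its trajectories started at each state `x`, together with its
transition matrix `trans`. -/
structure Chain (S : Type*) [MeasurableSpace S] where
  μ : S → Measure (ℕ → S)
  isProb : ∀ x, IsProbabilityMeasure (μ x)
  start : ∀ x, μ x {f | f 0 = x} = 1
  trans : S → S → ℝ≥0∞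
  trans_sum : ∀ x, ∑' y, trans x y = 1
  markov : ∀ x (n : ℕ) (s : ℕ → S),
    μ x {f | ∀ k ≤ n + 1, f k = s k} =
      μ x {f | ∀ k ≤ n, f k = s k} * trans (s n) (s (n + 1))

namespace Chain

variable {S : Type*} [MeasurableSpace S]

/-- Irreducibility: from every state one can reach every other state. -/
def Irreducible (C : Chain S) : Prop :=
  ∀ x y : S, ∃ n : ℕ, 0 < C.μ x {f | f n = y}

/-- Positive recurrence: the return time to each state is almost surely finite and
has finite expectation. -/
def PositiveRecurrent (C : Chain S) : Prop :=
  ∀ x : S, C.μ x {f | hit x f = ⊤} = 0 ∧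
    Integrable (fun f => ((hit x f).toNat : ℝ)) (C.μ x)

/-- Aperiodicity: for each state, the only common divisor of the possible return
times is `1`. -/
def Aperiodic (C : Chain S) : Prop :=
  ∀ x : S, ∀ d : ℕ, (∀ n : ℕ, 1 ≤ n → 0 < C.μ x {f | f n = x} → d ∣ n) → d ∣ 1

/-- `E_x[T_i]`, the expected hitting time of `i` starting from `x`. -/
def ERet (C : Chain S) (x i : S) : ℝ :=
  ∫ f, ((hit i f).toNat : ℝ) ∂ C.μ x

/-- The stationary probability `π_i = 1 / E_i[T_i]`. -/
def statPi (C : Chain S) (i : S) : ℝ := (C.ERet i i)⁻¹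

/-- The truncated mean `E_i[min(T_i, θ)]`. -/
def EThat (C : Chain S) (i : S) (θ : ℕ) : ℝ :=
  ∫ f, (truncHit i θ f : ℝ) ∂ C.μ i

/-- `E_i[F̂_j] = E_i[Σ_{s=1}^{min(T_i,θ)} 1{X_s = j}]`. -/
def EVisits (C : Chain S) (i j : S) (θ : ℕ) : ℝ :=
  ∫ f, (visits i j θ f : ℝ) ∂ C.μ i

/-- `P_i(T_i > k)`, as a real number. -/
def tailP (C : Chain S) (i : S) (k : ℕ) : ℝ :=
  (C.μ i {f | (k : ℕ∞) < hit i f}).toReal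

/-- The maximal hitting time `H_i = max_x E_x[T_i]`. -/
def maxHit (C : Chain S) (i : S) : ℝ := ⨆ x : S, C.ERet x i

/-- Entry `Z_{jk} = Σ_{t=0}^∞ (P^{(t)}_{jk} − π_k)` of the fundamental matrix. -/
def Zfun (C : Chain S) (j k : S) : ℝ :=
  ∑' t : ℕ, ((C.μ j {f | f t = k}).toReal - C.statPi k)

/-- `Z_max(i) = max_k |Z_{ki}|`. -/
def Zmax (C : Chain S) (i : S) : ℝ := ⨆ k : S, |C.Zfun k i|

end Chain



section Helpers

variable {S : Type*}

theorem natCast_lt_hit_iff (i : S) (n : ℕ) (f : ℕ → S) :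
    (n : ℕ∞) < hit i f ↔ ∀ m, 1 ≤ m → m ≤ n → f m ≠ i := by
  constructor
  · intro h m h1 hm he
    have : hit i f ≤ (m : ℕ∞) := sInf_le ⟨m, rfl, h1, he⟩
    exact absurd (h.trans_le this) (by simpa using hm)
  · intro h
    have : ((n + 1 : ℕ) : ℕ∞) ≤ hit i f := by
      refine le_sInf ?_
      rintro _ ⟨m, rfl, h1, he⟩
      by_contra hlt
      exact h m h1 (by have : m < n + 1 := by exact_mod_cast not_le.mp hlt
                       omega) he
    exact lt_of_lt_of_le (by exact_mod_cast Nat.lt_succ_self n) this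

theorem natCast_succ_lt_hit_iff (i : S) (n : ℕ) (f : ℕ → S) :
    ((n + 1 : ℕ) : ℕ∞) < hit i f ↔ (n : ℕ∞) < hit i f ∧ f (n + 1) ≠ i := by
  simp only [natCast_lt_hit_iff]
  constructor
  · exact fun h => ⟨fun m h1 hm => h m h1 (by omega), h _ (by omega) le_rfl⟩
  · rintro ⟨h, h'⟩ m h1 hm
    rcases Nat.lt_or_eq_of_le hm with hm | rfl
    · exact h m h1 (by omega)
    · exact h'

theorem zero_lt_hit (i : S) (f : ℕ → S) : ((0 : ℕ) : ℕ∞) < hit i f := by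
  rw [natCast_lt_hit_iff]
  intro m h1 h2
  omega

theorem tsum_natCast_lt_hit (i : S) (f : ℕ → S) (h : hit i f ≠ ⊤) :
    ∑' n : ℕ, (if (n : ℕ∞) < hit i f then (1 : ℝ≥0∞) else 0) = ((hit i f).toNat : ℝ≥0∞) := by
  obtain ⟨m, hm⟩ := ENat.ne_top_iff_exists.mp h
  rw [← hm, tsum_eq_sum (s := Finset.range m)]
  · rw [Finset.sum_congr rfl (g := fun _ => 1)]
    · simp
    · intro n hn
      simpa using hn
  · intro n hn
    simpa using hn

theorem tsum_natCast_lt_hit_of_eq_top (i : S) (f : ℕ → S) (h : hit i f = ⊤) :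
    ∑' n : ℕ, (if (n : ℕ∞) < hit i f then (1 : ℝ≥0∞) else 0) = ⊤ := by
  simp [h]

theorem lt_truncHit_iff (i : S) (θ n : ℕ) (f : ℕ → S) :
    n < truncHit i θ f ↔ n < θ ∧ (n : ℕ∞) < hit i f := by
  have h : ((truncHit i θ f : ℕ) : ℕ∞) = min (hit i f) θ :=
    ENat.natCast_toNat (ne_top_of_le_ne_top (ENat.natCast_ne_top θ) (min_le_right _ _))
  rw [← Nat.cast_lt (α := ℕ∞), h, lt_min_iff, Nat.cast_lt, and_comm]

theorem truncHit_eq_sum (i : S) (θ : ℕ) (f : ℕ → S) :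
    (truncHit i θ f : ℝ≥0∞) =
      ∑ n ∈ Finset.range θ, (if (n : ℕ∞) < hit i f then (1 : ℝ≥0∞) else 0) := by
  rw [Finset.sum_boole]
  congr 1
  conv_lhs => rw [← Finset.card_range (truncHit i θ f)]
  congr 1
  ext n
  simp [lt_truncHit_iff]

theorem visits_eq_sum (i j : S) (θ : ℕ) (f : ℕ → S) :
    (visits i j θ f : ℝ≥0∞) = ∑ n ∈ Finset.range θ,
      (if (n : ℕ∞) < hit i f ∧ f (n + 1) = j then (1 : ℝ≥0∞) else 0) := by
  rw [Finset.sum_boole]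
  congr 1
  symm
  refine Finset.card_bij (fun n _ => n + 1) ?_ (by simp) ?_
  · intro n hn
    simp only [Finset.mem_filter, Finset.mem_range, Finset.mem_Icc] at hn ⊢
    have := (lt_truncHit_iff i θ n f).mpr ⟨hn.1, hn.2.1⟩
    exact ⟨⟨by omega, by omega⟩, hn.2.2⟩
  · intro m hm
    simp only [Finset.mem_filter, Finset.mem_range, Finset.mem_Icc] at hm ⊢
    obtain ⟨n, rfl⟩ : ∃ n, m = n + 1 := ⟨m - 1, by omega⟩
    have := (lt_truncHit_iff i θ n f).mp (by omega)
    exact ⟨n, ⟨this.1, this.2, hm.2⟩, rfl⟩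

theorem measure_eq_tsum_inter_fiber {α β : Type*} [MeasurableSpace α] [Countable β]
    (μ : Measure α) (r : α → β) (hr : ∀ b, MeasurableSet (r ⁻¹' {b})) (B : Set α) :
    μ B = ∑' b, μ {a | a ∈ B ∧ r a = b} := by
  have h := tsum_measure_preimage_singleton (μ := μ.restrict B) (f := r) Set.countable_univ
    (fun b _ => hr b)
  rw [tsum_univ (fun b => (μ.restrict B) (r ⁻¹' {b}))] at h
  rw [Set.preimage_univ, Measure.restrict_apply_univ] at h
  rw [← h]
  refine tsum_congr fun b => ?_
  rw [Measure.restrict_apply (hr b), Set.inter_comm]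
  rfl

theorem lintegral_ite_one {α : Type*} [MeasurableSpace α] (μ : Measure α) {p : α → Prop}
    [DecidablePred p] (hp : MeasurableSet {a | p a}) :
    ∫⁻ a, (if p a then (1 : ℝ≥0∞) else 0) ∂μ = μ {a | p a} := by
  rw [← lintegral_indicator_one hp]
  simp only [Set.indicator_apply, Set.mem_ofPred_eq, Pi.one_apply]

variable [MeasurableSpace S]

namespace Chain

/-- The taboo probability `P_x(X_n = y, T_i > n)`. -/
def taboo (C : Chain S) (i : S) (n : ℕ) (x y : S) : ℝ≥0∞ :=
  C.μ x {f | f n = y ∧ (n : ℕ∞) < hit i f}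

/-- The expected hitting time of `j` from `x` as an extended nonnegative real,
`Σ_n P_x(T_j > n)`. -/
def meanHit (C : Chain S) (j x : S) : ℝ≥0∞ :=
  ∑' n : ℕ, C.μ x {f | (n : ℕ∞) < hit j f}

theorem taboo_eq (C : Chain S) (i : S) (n : ℕ) (x y : S) :
    C.taboo i n x y = C.μ x {f | f ∈ {f | (n : ℕ∞) < hit i f} ∧ f n = y} := by
  simp only [taboo, Set.mem_ofPred_eq, and_comm]

end Chain

variable [MeasurableSingletonClass S]

theorem measurableSet_coord_eq (k : ℕ) (s : S) : MeasurableSet {f : ℕ → S | f k = s} :=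
  (measurable_pi_apply (X := fun _ : ℕ => S) k) (measurableSet_singleton s)

theorem measurableSet_natCast_lt_hit (i : S) (n : ℕ) :
    MeasurableSet {f : ℕ → S | (n : ℕ∞) < hit i f} := by
  simp only [natCast_lt_hit_iff, Set.ofPred_forall]
  exact MeasurableSet.iInter fun m => MeasurableSet.iInter fun _ => MeasurableSet.iInter fun _ =>
    (measurableSet_coord_eq m i).compl

namespace Chain

theorem taboo_zero (C : Chain S) (i x y : S) :
    C.taboo i 0 x y = if y = x then 1 else 0 := by
  have := C.isProb x
  have e : C.taboo i 0 x y = C.μ x {f | f 0 = y} := by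
    simp only [taboo, zero_lt_hit, and_true]
  rw [e]
  split_ifs with h
  · rw [h, C.start x]
  · have h0 := (prob_compl_eq_zero_iff (measurableSet_coord_eq 0 x)).mpr (C.start x)
    refine measure_mono_null ?_ h0
    rintro f rfl hf
    exact h hf

theorem meanHit_eq_lintegral (C : Chain S) (j x : S) :
    C.meanHit j x = ∫⁻ f, ∑' n : ℕ, (if (n : ℕ∞) < hit j f then (1 : ℝ≥0∞) else 0) ∂C.μ x := by
  rw [lintegral_tsum]
  · refine tsum_congr fun n => ?_
    rw [lintegral_ite_one _ (measurableSet_natCast_lt_hit j n)]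
  · exact fun n => (Measurable.ite (measurableSet_natCast_lt_hit j n)
      measurable_const measurable_const).aemeasurable

theorem meanHit_self_ne_top (C : Chain S) (hrec : C.PositiveRecurrent) (j : S) :
    C.meanHit j j ≠ ⊤ := by
  have hfin : ∀ᵐ f ∂C.μ j, hit j f ≠ ⊤ := by
    rw [ae_iff]
    simpa using (hrec j).1
  rw [meanHit_eq_lintegral, lintegral_congr_ae
    (hfin.mono fun f hf => tsum_natCast_lt_hit j f hf)]
  have := (hrec j).2.lintegral_lt_top
  simpa using this.ne

theorem eRet_eq_toReal_meanHit (C : Chain S) (j x : S) (h : C.meanHit j x ≠ ⊤) :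
    C.ERet x j = (C.meanHit j x).toReal := by
  have hm : Measurable fun f : ℕ → S =>
      ∑' n : ℕ, (if (n : ℕ∞) < hit j f then (1 : ℝ≥0∞) else 0) :=
    Measurable.tsum fun n => Measurable.ite (measurableSet_natCast_lt_hit j n)
      measurable_const measurable_const
  rw [meanHit_eq_lintegral] at h ⊢
  have hfin := ae_lt_top hm h
  rw [ERet, ← integral_toReal hm.aemeasurable hfin]
  refine integral_congr_ae (hfin.mono fun f hf => ?_)
  have hf' : hit j f ≠ ⊤ := fun ht => hf.ne (tsum_natCast_lt_hit_of_eq_top j f ht)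
  simp only [tsum_natCast_lt_hit j f hf', ENNReal.toReal_natCast]

end Chain

variable [Countable S]

namespace Chain

/-- One-step Markov property for events determined by the trajectory up to time `n`. -/
theorem measure_succ (C : Chain S) (x : S) (n : ℕ) (A : Set (ℕ → S))
    (hA : ∀ f g : ℕ → S, (∀ k ≤ n, f k = g k) → f ∈ A → g ∈ A) (z y : S) :
    C.μ x {f | (f ∈ A ∧ f (n + 1) = y) ∧ f n = z} =
      C.μ x {f | f ∈ A ∧ f n = z} * C.trans z y := by
  let r : (ℕ → S) → (Fin (n + 1) → S) := fun f k => f k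
  have hr : ∀ w, MeasurableSet (r ⁻¹' {w}) := fun w =>
    (measurable_pi_lambda r fun k => measurable_pi_apply _) (measurableSet_singleton w)
  rw [measure_eq_tsum_inter_fiber (C.μ x) r hr, measure_eq_tsum_inter_fiber (C.μ x) r hr,
    ← ENNReal.tsum_mul_right]
  refine tsum_congr fun w => ?_
  let s : ℕ → S := fun k => if h : k < n + 1 then w ⟨k, h⟩ else y
  have hrs : ∀ f, r f = w ↔ ∀ k ≤ n, f k = s k := by
    intro f
    constructor
    · rintro rfl k hk
      simp only [s, dif_pos (Nat.lt_succ_of_le hk), r]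
    · intro h
      ext k
      have := h k (Nat.le_of_lt_succ k.2)
      simpa only [s, dif_pos k.2, r] using this
  have hsy : s (n + 1) = y := by simp [s]
  by_cases hs : s ∈ A ∧ s n = z
  · have h := C.markov x n s
    rw [hs.2, hsy] at h
    convert h using 2
    · congr 1
      ext f
      simp only [Set.mem_ofPred_eq, hrs]
      constructor
      · rintro ⟨⟨⟨-, hy⟩, -⟩, hk⟩ k hkn
        rcases Nat.lt_or_eq_of_le hkn with hkn | rfl
        · exact hk k (by omega)
        · rw [hy, hsy]
      · intro hk
        refine ⟨⟨⟨hA s f (fun k hkn => (hk k (by omega)).symm) hs.1, ?_⟩, ?_⟩,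
          fun k hkn => hk k (by omega)⟩
        · rw [hk _ le_rfl, hsy]
        · rw [hk n (by omega), hs.2]
    · congr 1
      ext f
      simp only [Set.mem_ofPred_eq, hrs]
      exact ⟨fun hk => hk.2, fun hk => ⟨⟨hA s f (fun k hkn => (hk k hkn).symm) hs.1,
        (hk n le_rfl).trans hs.2⟩, hk⟩⟩
  · have key : ∀ f, (f ∈ A ∧ f n = z) → ¬ r f = w := fun f hf hw => by
      rw [hrs] at hw
      exact hs ⟨hA f s hw hf.1, (hw n le_rfl).symm.trans hf.2⟩
    have e1 : {a | a ∈ {f | (f ∈ A ∧ f (n + 1) = y) ∧ f n = z} ∧ r a = w} = ∅ := by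
      ext f
      simp only [Set.mem_ofPred_eq, Set.mem_empty_iff_false, iff_false]
      exact fun h => key f ⟨h.1.1.1, h.1.2⟩ h.2
    have e2 : {a | a ∈ {f | f ∈ A ∧ f n = z} ∧ r a = w} = ∅ := by
      ext f
      simp only [Set.mem_ofPred_eq, Set.mem_empty_iff_false, iff_false]
      exact fun h => key f h.1 h.2
    rw [e1, e2]
    simp

theorem measure_succ_eq_tsum (C : Chain S) (x : S) (n : ℕ) (A : Set (ℕ → S))
    (hA : ∀ f g : ℕ → S, (∀ k ≤ n, f k = g k) → f ∈ A → g ∈ A) (y : S) :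
    C.μ x {f | f ∈ A ∧ f (n + 1) = y} = ∑' z, C.μ x {f | f ∈ A ∧ f n = z} * C.trans z y := by
  rw [measure_eq_tsum_inter_fiber (C.μ x) (fun f => f n) (measurableSet_coord_eq n)]
  exact tsum_congr fun z => C.measure_succ x n A hA z y

theorem tsum_taboo (C : Chain S) (i : S) (n : ℕ) (x : S) :
    ∑' y, C.taboo i n x y = C.μ x {f | (n : ℕ∞) < hit i f} := by
  rw [measure_eq_tsum_inter_fiber (C.μ x) (fun f => f n) (measurableSet_coord_eq n)]
  exact tsum_congr fun y => C.taboo_eq i n x y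

theorem measure_natCast_lt_hit_succ (C : Chain S) (i : S) (n : ℕ) (x y : S) :
    C.μ x {f | (n : ℕ∞) < hit i f ∧ f (n + 1) = y} =
      ∑' z, C.taboo i n x z * C.trans z y := by
  simp only [taboo_eq]
  refine C.measure_succ_eq_tsum x n {f | (n : ℕ∞) < hit i f} ?_ y
  intro f g hfg hf
  simp only [Set.mem_ofPred_eq, natCast_lt_hit_iff] at hf ⊢
  exact fun m h1 hm => hfg m hm ▸ hf m h1 hm

theorem taboo_succ (C : Chain S) (i : S) (n : ℕ) (x y : S) :
    C.taboo i (n + 1) x y = if y = i then 0 else ∑' z, C.taboo i n x z * C.trans z y := by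
  rw [← measure_natCast_lt_hit_succ, taboo]
  simp only [natCast_succ_lt_hit_iff]
  split_ifs with h
  · subst h
    convert measure_empty (μ := C.μ x)
    aesop
  · congr 1
    ext f
    simp only [Set.mem_ofPred_eq]
    grind

theorem taboo_succ' (C : Chain S) (i : S) (n : ℕ) (x y : S) :
    C.taboo i (n + 1) x y = ∑' z, C.trans x z * (if z = i then 0 else C.taboo i n z y) := by
  induction n generalizing y with
  | zero =>
    rw [taboo_succ, tsum_eq_single x, tsum_eq_single y]
    · simp [taboo_zero]
    · intro z hz
      simp [taboo_zero, hz.symm]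
    · intro z hz
      simp [taboo_zero, hz]
  | succ n ih =>
    rw [taboo_succ]
    split_ifs with h
    · simp [taboo_succ, h]
    · simp only [ih, ← ENNReal.tsum_mul_right]
      rw [ENNReal.tsum_comm]
      refine tsum_congr fun z => ?_
      simp only [mul_assoc, ENNReal.tsum_mul_left]
      congr 1
      split_ifs with hz
      · simp
      · rw [taboo_succ, if_neg h]

theorem meanHit_eq (C : Chain S) (j x : S) :
    C.meanHit j x = 1 + ∑' z, C.trans x z * (if z = j then 0 else C.meanHit j z) := by
  have := C.isProb x
  rw [meanHit, tsum_eq_zero_add' ENNReal.summable]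
  congr 1
  · simp only [zero_lt_hit, Set.ofPred_true, measure_univ]
  · simp only [← tsum_taboo, taboo_succ']
    simp only [fun n => ENNReal.tsum_comm (f := fun y z =>
      C.trans x z * (if z = j then 0 else C.taboo j n z y))]
    rw [ENNReal.tsum_comm]
    refine tsum_congr fun z => ?_
    simp only [ENNReal.tsum_mul_left]
    congr 1
    split_ifs with hz
    · simp
    · simp only [tsum_taboo, meanHit]

theorem meanHit_ne_top (C : Chain S) (hirr : C.Irreducible) (hrec : C.PositiveRecurrent)
    (j x : S) : C.meanHit j x ≠ ⊤ := by
  have step : ∀ z y, C.meanHit j z ≠ ⊤ → C.trans z y ≠ 0 → C.meanHit j y ≠ ⊤ := by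
    intro z y hz hzy
    rcases eq_or_ne y j with rfl | hyj
    · exact C.meanHit_self_ne_top hrec y
    intro hy
    refine hz ?_
    rw [meanHit_eq, ENNReal.add_eq_top]
    refine Or.inr (ENNReal.tsum_eq_top_of_eq_top ⟨y, ?_⟩)
    rw [if_neg hyj, hy, ENNReal.mul_top hzy]
  have reach : ∀ n y, C.μ j {f | f n = y} ≠ 0 → C.meanHit j y ≠ ⊤ := by
    intro n
    induction n with
    | zero =>
      intro y hy
      have h := C.taboo_zero j j y
      simp only [taboo, zero_lt_hit, and_true] at h
      rw [h] at hy
      simp only [ne_eq, ite_eq_right_iff, one_ne_zero, imp_false, not_not] at hy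
      exact hy ▸ C.meanHit_self_ne_top hrec j
    | succ n ih =>
      intro y hy
      have h := C.measure_succ_eq_tsum j n Set.univ (fun _ _ _ _ => trivial) y
      simp only [Set.mem_univ, true_and] at h
      rw [h, ne_eq, ENNReal.tsum_eq_zero, not_forall] at hy
      obtain ⟨z, hz⟩ := hy
      rw [mul_eq_zero, not_or] at hz
      exact step z y (ih z hz.1) hz.2
  obtain ⟨n, hn⟩ := hirr j x
  exact reach n x hn.ne'

theorem eThat_eq (C : Chain S) (i : S) (θ : ℕ) :
    C.EThat i θ = (∑ n ∈ Finset.range θ, ∑' x, C.taboo i n i x).toReal := by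
  have hm : ∀ n : ℕ, Measurable fun f : ℕ → S =>
      (if (n : ℕ∞) < hit i f then (1 : ℝ≥0∞) else 0) := fun n =>
    Measurable.ite (measurableSet_natCast_lt_hit i n) measurable_const measurable_const
  have e : ∫⁻ f, (truncHit i θ f : ℝ≥0∞) ∂C.μ i =
      ∑ n ∈ Finset.range θ, ∑' x, C.taboo i n i x := by
    simp only [truncHit_eq_sum, tsum_taboo]
    rw [lintegral_finsetSum _ fun n _ => hm n]
    refine Finset.sum_congr rfl fun n _ => ?_
    rw [lintegral_ite_one _ (measurableSet_natCast_lt_hit i n)]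
  rw [← e, EThat, ← integral_toReal]
  · simp
  · simp only [truncHit_eq_sum]
    exact (Finset.measurable_fun_sum _ fun n _ => hm n).aemeasurable
  · simp

theorem eVisits_eq (C : Chain S) (i j : S) (θ : ℕ) :
    C.EVisits i j θ =
      (∑ n ∈ Finset.range θ, ∑' x, C.taboo i n i x * C.trans x j).toReal := by
  have hs : ∀ n : ℕ, MeasurableSet {f : ℕ → S | (n : ℕ∞) < hit i f ∧ f (n + 1) = j} := fun n =>
    (measurableSet_natCast_lt_hit i n).inter (measurableSet_coord_eq (n + 1) j)
  have hm : ∀ n : ℕ, Measurable fun f : ℕ → S =>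
      (if (n : ℕ∞) < hit i f ∧ f (n + 1) = j then (1 : ℝ≥0∞) else 0) := fun n =>
    Measurable.ite (hs n) measurable_const measurable_const
  have e : ∫⁻ f, (visits i j θ f : ℝ≥0∞) ∂C.μ i =
      ∑ n ∈ Finset.range θ, ∑' x, C.taboo i n i x * C.trans x j := by
    simp only [visits_eq_sum, ← measure_natCast_lt_hit_succ]
    rw [lintegral_finsetSum _ fun n _ => hm n]
    refine Finset.sum_congr rfl fun n _ => ?_
    rw [lintegral_ite_one _ (hs n)]
  rw [← e, EVisits, ← integral_toReal]
  · simp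
  · simp only [visits_eq_sum]
    exact (Finset.measurable_fun_sum _ fun n _ => hm n).aemeasurable
  · simp

/-- Pushing a weight through one step of the chain, split according to whether the step
lands in `i`. -/
theorem tsum_taboo_step (C : Chain S) (i : S) (n : ℕ) (h : S → ℝ≥0∞) :
    ∑' x, C.taboo i n i x * ∑' y, C.trans x y * h y =
      ∑' y, C.taboo i (n + 1) i y * h y + (∑' x, C.taboo i n i x * C.trans x i) * h i := by
  have e1 : ∑' x, C.taboo i n i x * ∑' y, C.trans x y * h y =
      ∑' y, (∑' x, C.taboo i n i x * C.trans x y) * h y := by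
    simp only [← ENNReal.tsum_mul_left, ← ENNReal.tsum_mul_right]
    rw [ENNReal.tsum_comm]
    simp only [mul_assoc]
  have e2 : ∀ y, (∑' x, C.taboo i n i x * C.trans x y) * h y = C.taboo i (n + 1) i y * h y +
      if y = i then (∑' x, C.taboo i n i x * C.trans x i) * h i else 0 := by
    intro y
    rw [taboo_succ]
    split_ifs with hy
    · simp [hy]
    · simp
  rw [e1, tsum_congr e2, ENNReal.tsum_add, tsum_ite_eq]

theorem sum_return_add_tsum_taboo (C : Chain S) (i : S) (n : ℕ) :
    ∑ m ∈ Finset.range n, (∑' x, C.taboo i m i x * C.trans x i) +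
      ∑' y, C.taboo i n i y = 1 := by
  induction n with
  | zero => simp [taboo_zero]
  | succ n ih =>
    have h := C.tsum_taboo_step i n 1
    simp only [Pi.one_apply, mul_one, C.trans_sum] at h
    rw [Finset.sum_range_succ, ← ih, h]
    ring

/-- Optional stopping at `min(T_i, n)` for the martingale
`E_{X_n}[T_j] + n - E_j[T_j] N_n`, where `N_n` counts the visits to `j` at times `1, …, n`. -/
theorem meanHit_balance (C : Chain S) (i j : S) (n : ℕ) :
    C.meanHit j j * ∑ m ∈ Finset.range n, (∑' x, C.taboo i m i x * C.trans x j) +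
        C.meanHit j i =
      ∑ m ∈ Finset.range n, (∑' x, C.taboo i m i x) +
        ∑' y, C.taboo i n i y * C.meanHit j y +
        (∑ m ∈ Finset.range n, (∑' x, C.taboo i m i x * C.trans x i)) * C.meanHit j i := by
  induction n with
  | zero => simp [taboo_zero]
  | succ n ih =>
    have h1 : ∀ x, C.meanHit j x + C.trans x j * C.meanHit j j =
        1 + ∑' y, C.trans x y * C.meanHit j y := by
      intro x
      rw [C.meanHit_eq j x, add_assoc]
      congr 1
      rw [← tsum_ite_eq j (fun _ => C.trans x j * C.meanHit j j), ← ENNReal.tsum_add]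
      refine tsum_congr fun y => ?_
      split_ifs with hy <;> simp [hy]
    have h2 : ∑' y, C.taboo i n i y * C.meanHit j y +
        C.meanHit j j * ∑' x, C.taboo i n i x * C.trans x j =
        ∑' x, C.taboo i n i x + ∑' x, C.taboo i n i x * ∑' y, C.trans x y * C.meanHit j y := by
      rw [← ENNReal.tsum_mul_left, ← ENNReal.tsum_add, ← ENNReal.tsum_add]
      refine tsum_congr fun x => ?_
      rw [← mul_one_add (C.taboo i n i x), ← h1]
      ring
    rw [tsum_taboo_step] at h2
    simp only [Finset.sum_range_succ]
    calc _ = C.meanHit j j * ∑ m ∈ Finset.range n, (∑' x, C.taboo i m i x * C.trans x j) +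
        C.meanHit j i + C.meanHit j j * ∑' x, C.taboo i n i x * C.trans x j := by ring
      _ = ∑ m ∈ Finset.range n, (∑' x, C.taboo i m i x) +
        (∑ m ∈ Finset.range n, (∑' x, C.taboo i m i x * C.trans x i)) * C.meanHit j i +
        (∑' y, C.taboo i n i y * C.meanHit j y +
        C.meanHit j j * ∑' x, C.taboo i n i x * C.trans x j) := by rw [ih]; ring
      _ = _ := by rw [h2]; ring

end Chain

end Helpers

/-- Lemma 13 of the paper, rewritten via
`Z_ij − Z_qj = π_j (E_q[T_j] − E_i[T_j])`. For `i ≠ j` with all expected hitting times of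
`j` finite, and `Ê = E_i[min(T_i, θ)]`,
`E_i[F̂_j]/Ê − π_j = (π_j/Ê) · Σ_{q ≠ i} P_i(X_θ = q, T_i > θ)·(E_q[T_j] − E_i[T_j])`. -/
theorem statement8 {S : Type*} [MeasurableSpace S] [MeasurableSingletonClass S] [Countable S]
    (C : Chain S) (hirr : C.Irreducible) (hrec : C.PositiveRecurrent)
    (i j : S) (hij : i ≠ j)
    (hfin : ∀ x : S, Integrable (fun f => ((hit j f).toNat : ℝ)) (C.μ x))
    (θ : ℕ) (hθ : 1 ≤ θ) :
    C.EVisits i j θ / C.EThat i θ - C.statPi j =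
      C.statPi j / C.EThat i θ *
        ∑' q : {q : S // q ≠ i},
          (C.μ i {f | f θ = (q : S) ∧ (θ : ℕ∞) < hit i f}).toReal *
            (C.ERet (q : S) j - C.ERet i j) := by
  have := C.isProb i
  have hH := C.meanHit_ne_top hirr hrec j
  have hR : ∀ x, C.ERet x j = (C.meanHit j x).toReal := fun x =>
    C.eRet_eq_toReal_meanHit j x (hH x)
  have hbal := C.meanHit_balance i j θ
  have hone := C.sum_return_add_tsum_taboo i θ
  have hle : ∀ n, ∑' x, C.taboo i n i x ≤ 1 := fun n => by
    rw [C.tsum_taboo]; exact prob_le_one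
  have hVle : ∀ n, ∑' x, C.taboo i n i x * C.trans x j ≤ 1 := fun n => by
    rw [← C.measure_natCast_lt_hit_succ]; exact prob_le_one
  set V := ∑ n ∈ Finset.range θ, ∑' x, C.taboo i n i x * C.trans x j with hV
  set T := ∑ n ∈ Finset.range θ, ∑' x, C.taboo i n i x with hT
  set A := ∑' y, C.taboo i θ i y with hA
  set B := ∑' y, C.taboo i θ i y * C.meanHit j y with hB
  set R := ∑ n ∈ Finset.range θ, ∑' x, C.taboo i n i x * C.trans x i with hRdef
  have hVtop : V ≠ ⊤ := ENNReal.sum_ne_top.mpr fun n _ =>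
    ne_top_of_le_ne_top ENNReal.one_ne_top (hVle n)
  have hTtop : T ≠ ⊤ := ENNReal.sum_ne_top.mpr fun n _ =>
    ne_top_of_le_ne_top ENNReal.one_ne_top (hle n)
  have hAtop : A ≠ ⊤ := ne_top_of_le_ne_top ENNReal.one_ne_top (hle θ)
  have hRtop : R ≠ ⊤ := ne_top_of_le_ne_top ENNReal.one_ne_top (hone ▸ le_self_add)
  have hBtop : B ≠ ⊤ := by
    refine ne_top_of_le_ne_top
      (ENNReal.add_ne_top.mpr ⟨ENNReal.mul_ne_top (hH j) hVtop, hH i⟩) ?_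
    rw [hbal]
    exact le_self_add.trans' le_add_self
  have hT1 : 1 ≤ T.toReal := by
    rw [← ENNReal.toReal_one]
    refine ENNReal.toReal_mono hTtop ?_
    have h0 : ∑' x, C.taboo i 0 i x = 1 := by simp [Chain.taboo_zero]
    rw [← h0]
    exact Finset.single_le_sum (f := fun n => ∑' x, C.taboo i n i x) (fun _ _ => zero_le)
      (Finset.mem_range.mpr hθ)
  have hj1 : 1 ≤ (C.meanHit j j).toReal := by
    rw [← ENNReal.toReal_one]
    refine ENNReal.toReal_mono (hH j) ?_
    rw [C.meanHit_eq]
    exact le_self_add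
  have hbal' : (C.meanHit j j).toReal * V.toReal + (C.meanHit j i).toReal =
      T.toReal + B.toReal + R.toReal * (C.meanHit j i).toReal := by
    have h := congrArg ENNReal.toReal hbal
    rwa [ENNReal.toReal_add (ENNReal.mul_ne_top (hH j) hVtop) (hH i),
      ENNReal.toReal_add (ENNReal.add_ne_top.mpr ⟨hTtop, hBtop⟩)
        (ENNReal.mul_ne_top hRtop (hH i)),
      ENNReal.toReal_add hTtop hBtop, ENNReal.toReal_mul, ENNReal.toReal_mul] at h
  have hone' : R.toReal + A.toReal = 1 := by
    rw [← ENNReal.toReal_add hRtop hAtop, hone, ENNReal.toReal_one]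
  have hsum : ∑' q : {q : S // q ≠ i},
      (C.μ i {f | f θ = (q : S) ∧ (θ : ℕ∞) < hit i f}).toReal *
        (C.ERet (q : S) j - C.ERet i j) = B.toReal - A.toReal * (C.meanHit j i).toReal := by
    have hBs : HasSum (fun q => (C.taboo i θ i q * C.meanHit j q).toReal) B.toReal := by
      rw [hB, ENNReal.tsum_toReal_eq (ENNReal.ne_top_of_tsum_ne_top hBtop)]
      exact ENNReal.hasSum_toReal hBtop
    have hAs : HasSum (fun q => (C.taboo i θ i q).toReal) A.toReal := by
      rw [hA, ENNReal.tsum_toReal_eq (ENNReal.ne_top_of_tsum_ne_top hAtop)]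
      exact ENNReal.hasSum_toReal hAtop
    have hs := hBs.sub (hAs.mul_right (C.meanHit j i).toReal)
    have hsupp : Function.support (fun q => (C.taboo i θ i q * C.meanHit j q).toReal -
        (C.taboo i θ i q).toReal * (C.meanHit j i).toReal) ⊆ {q | q ≠ i} := by
      rintro q hq rfl
      obtain ⟨n, rfl⟩ : ∃ n, θ = n + 1 := ⟨θ - 1, by omega⟩
      simp [Chain.taboo_succ] at hq
    rw [← hs.tsum_eq, ← tsum_subtype_eq_of_support_subset hsupp]
    refine tsum_congr fun q => ?_
    rw [hR, hR, ENNReal.toReal_mul, ← mul_sub]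
    rfl
  rw [hsum, C.eVisits_eq, C.eThat_eq, Chain.statPi, hR, ← hV, ← hT]
  have hT0 : T.toReal ≠ 0 := by linarith
  have hj0 : (C.meanHit j j).toReal ≠ 0 := by linarith
  field_simp
  linear_combination hbal' + (C.meanHit j i).toReal * hone'

end

end LocalStationary
end

section
/- Let {X_t} satisfy Assumption L. Then for every i ∈ B and every positive integer k, the return-time tail satisfies P_i(T_i > k) ≤ 4 · 2^{−k/R_i}, where R_i = 2·H_i^B·( 1.25·e^{2η ν_max}/((1−ρ)(e^{η ν_max} − ρ)) + 1 ) + ln(2)·e^{η ν_max}/(0.8(1−ρ)). -/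
open MeasureTheory ProbabilityTheory Finset Set
open scoped ENNReal NNReal Classical

namespace LocalStationary

noncomputable section

/-- Lyapunov data witnessing Assumption L for the chain `C`: a nonnegative function `V`
with bounded jumps along transitions, uniform negative drift `−γ` outside the finite
sublevel set `B = {x | V x ≤ b}`. -/
structure LyapunovData {S : Type*} [MeasurableSpace S] (C : Chain S) where
  V : S → ℝ
  nuMax : ℝ
  gam : ℝ
  b : ℝ
  V_nonneg : ∀ x, 0 ≤ V x
  nuMax_pos : 0 < nuMax
  gam_pos : 0 < gam
  b_nonneg : 0 ≤ b
  finiteB : {x : S | V x ≤ b}.Finite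
  bounded_jump : ∀ x y, C.trans x y ≠ 0 → |V y - V x| ≤ nuMax
  drift : ∀ x, b < V x → ∑' y, (C.trans x y).toReal * (V y - V x) < -gam

namespace LyapunovData

variable {S : Type*} [MeasurableSpace S] {C : Chain S}

/-- The finite set `B = {x | V x ≤ b}`. -/
def B (L : LyapunovData C) : Set S := {x | L.V x ≤ L.b}

/-- `η = γ / (2(e−2)ν_max²)`. -/
def eta (L : LyapunovData C) : ℝ := L.gam / (2 * (Real.exp 1 - 2) * L.nuMax ^ 2)

/-- `ρ = 1 − γ² / (4(e−2)ν_max²)`. -/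
def rho (L : LyapunovData C) : ℝ := 1 - L.gam ^ 2 / (4 * (Real.exp 1 - 2) * L.nuMax ^ 2)

/-- The number of time-steps `1 ≤ s ≤ T_i` at which the trajectory is in `B`, i.e. the
hitting time of `i` for the chain watched on its successive visits to `B`. -/
def watchCount (L : LyapunovData C) (i : S) (f : ℕ → S) : ℕ :=
  ((Finset.Icc 1 ((hit i f).toNat)).filter fun s => f s ∈ L.B).card

/-- `H_i^B`: the maximal (over starting states in `B`) expected hitting time of `i`
for the chain watched on `B`. -/
def HB (L : LyapunovData C) (i : S) : ℝ :=
  ⨆ j : L.B, ∫ f, (L.watchCount i f : ℝ) ∂ C.μ (j : S)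

/-- The constant `R_i` of the paper. -/
def R (L : LyapunovData C) (i : S) : ℝ :=
  2 * L.HB i * (1.25 * Real.exp (2 * L.eta * L.nuMax) /
      ((1 - L.rho) * (Real.exp (L.eta * L.nuMax) - L.rho)) + 1) +
    Real.log 2 * Real.exp (L.eta * L.nuMax) / (0.8 * (1 - L.rho))

/-- `S_m`, the time of the `m`-th visit (after time 0) of the trajectory to `B`
(equal to `⊤` if there is no such visit). -/
def visitTime (L : LyapunovData C) (f : ℕ → S) : ℕ → ℕ∞
  | 0 => 0
  | m + 1 => sInf {n : ℕ∞ | ∃ k : ℕ, n = (k : ℕ∞) ∧ visitTime L f m < (k : ℕ∞) ∧ f k ∈ L.B}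

end LyapunovData


/-- The trajectory seen from time `1` on. -/
def shift {S : Type*} (f : ℕ → S) : ℕ → S := fun n => f (n + 1)

/-- The trajectories that agree with `s` up to time `n`. -/
def cyl {S : Type*} (n : ℕ) (s : ℕ → S) : Set (ℕ → S) := {f | ∀ k ≤ n, f k = s k}

/-- The trajectory `s` preceded by the state `x`. -/
def prepend {S : Type*} (x : S) (s : ℕ → S) : ℕ → S
  | 0 => x
  | n + 1 => s n

section FirstStep

variable {S : Type*}

lemma isPiSystem_cyl : IsPiSystem {A : Set (ℕ → S) | ∃ n s, A = cyl n s} := by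
  rintro _ ⟨n, s, rfl⟩ _ ⟨m, t, rfl⟩ ⟨f, hf, hg⟩
  refine ⟨max n m, f, ?_⟩
  ext g
  constructor
  · rintro ⟨h1, h2⟩ k hk
    rcases le_max_iff.1 hk with h | h
    · rw [h1 k h, hf k h]
    · rw [h2 k h, hg k h]
  · intro h
    exact ⟨fun k hk => (h k (hk.trans (le_max_left _ _))).trans (hf k hk),
      fun k hk => (h k (hk.trans (le_max_right _ _))).trans (hg k hk)⟩

variable [MeasurableSpace S]

instance (C : Chain S) (x : S) : IsProbabilityMeasure (C.μ x) := C.isProb x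

lemma measurable_shift : Measurable (shift : (ℕ → S) → ℕ → S) :=
  measurable_pi_lambda _ fun n => measurable_pi_apply (n + 1)

lemma Chain.measure_cyl_zero (C : Chain S) (s : ℕ → S) : C.μ (s 0) (cyl 0 s) = 1 := by
  rw [← C.start (s 0)]
  congr 1
  ext f
  simp [cyl]

lemma Chain.measure_cyl_prepend (C : Chain S) (x : S) (n : ℕ) (s : ℕ → S) :
    C.μ x (cyl (n + 1) (prepend x s)) = C.trans x (s 0) * C.μ (s 0) (cyl n s) := by
  induction n with
  | zero =>
    have h := C.markov x 0 (prepend x s)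
    have h0 := C.measure_cyl_zero (prepend x s)
    change C.μ x (cyl 0 (prepend x s)) = 1 at h0
    change C.μ x (cyl 1 (prepend x s)) = C.μ x (cyl 0 (prepend x s)) * C.trans x (s 0) at h
    rw [h, h0, C.measure_cyl_zero s, mul_comm]
  | succ n ih =>
    have h := C.markov x (n + 1) (prepend x s)
    have h' := C.markov (s 0) n s
    change C.μ x (cyl (n + 2) (prepend x s)) =
      C.μ x (cyl (n + 1) (prepend x s)) * C.trans (s n) (s (n + 1)) at h
    change C.μ (s 0) (cyl (n + 1) s) = C.μ (s 0) (cyl n s) * C.trans (s n) (s (n + 1)) at h'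
    rw [h, h', ih, mul_assoc]

variable [MeasurableSingletonClass S] [Countable S]

lemma measurableSet_apply_mem (n : ℕ) (A : Set S) : MeasurableSet {f : ℕ → S | f n ∈ A} :=
  measurable_pi_apply n A.to_countable.measurableSet

lemma measurableSet_cyl (n : ℕ) (s : ℕ → S) : MeasurableSet (cyl n s) := by
  have : cyl n s = ⋂ k, ⋂ (_ : k ≤ n), {f | f k ∈ ({s k} : Set S)} := by
    ext f; simp [cyl]
  rw [this]
  exact MeasurableSet.iInter fun k => MeasurableSet.iInter fun _ => measurableSet_apply_mem _ _

lemma generateFrom_cyl :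
    (MeasurableSpace.pi : MeasurableSpace (ℕ → S)) =
      MeasurableSpace.generateFrom {A | ∃ n s, A = cyl n s} := by
  apply le_antisymm
  · refine iSup_le fun n => ?_
    rintro _ ⟨A, -, rfl⟩
    have : (fun f : ℕ → S => f n) ⁻¹' A =
        ⋃ w : {w : Fin (n + 1) → S // w (Fin.last n) ∈ A},
          cyl n (fun k => if h : k < n + 1 then w.1 ⟨k, h⟩ else w.1 (Fin.last n)) := by
      ext f
      simp only [Set.mem_preimage, Set.mem_iUnion]
      constructor
      · intro h
        refine ⟨⟨fun k => f k, by simpa using h⟩, ?_⟩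
        intro k hk
        simp [Nat.lt_succ_of_le hk]
      · rintro ⟨⟨w, hw⟩, h⟩
        have := h n le_rfl
        simp only [Nat.lt_succ_self, dif_pos] at this
        rw [this]
        exact hw
    change @MeasurableSet _ (MeasurableSpace.generateFrom _) _
    rw [this]
    exact MeasurableSet.iUnion fun w => MeasurableSpace.measurableSet_generateFrom ⟨_, _, rfl⟩
  · refine MeasurableSpace.generateFrom_le ?_
    rintro _ ⟨n, s, rfl⟩
    exact measurableSet_cyl n s

namespace Chain

variable (C : Chain S)

lemma ae_start (x : S) : ∀ᵐ f ∂C.μ x, f 0 = x := by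
  have h : MeasurableSet {f : ℕ → S | f 0 = x} := measurableSet_apply_mem 0 {x}
  exact (prob_compl_eq_zero_iff h).2 (C.start x)

lemma measure_cyl_eq_zero {y : S} {s : ℕ → S} (n : ℕ) (h : s 0 ≠ y) : C.μ y (cyl n s) = 0 := by
  refine measure_mono_null ?_ (ae_iff.1 (C.ae_start y))
  exact fun f hf hy => h ((hf 0 (Nat.zero_le _)).symm.trans hy)

lemma map_shift (x : S) :
    (C.μ x).map shift = Measure.sum fun y => C.trans x y • C.μ y := by
  have : IsProbabilityMeasure ((C.μ x).map shift) :=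
    Measure.isProbabilityMeasure_map measurable_shift.aemeasurable
  refine ext_of_generate_finite _ generateFrom_cyl isPiSystem_cyl ?_ ?_
  · rintro _ ⟨n, s, rfl⟩
    rw [Measure.map_apply measurable_shift (measurableSet_cyl n s),
      Measure.sum_apply _ (measurableSet_cyl n s), tsum_eq_single (s 0)]
    · rw [Measure.smul_apply, smul_eq_mul, ← C.measure_cyl_prepend]
      refine measure_congr ?_
      filter_upwards [C.ae_start x] with f hf
      refine propext ⟨fun h k hk => ?_, fun h k hk => h (k + 1) (Nat.succ_le_succ hk)⟩
      cases k with
      | zero => exact hf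
      | succ k => exact h k (Nat.le_of_succ_le_succ hk)
    · intro y hy
      rw [Measure.smul_apply, C.measure_cyl_eq_zero n hy.symm, smul_zero]
  · rw [measure_univ, Measure.sum_apply _ MeasurableSet.univ]
    simp [C.trans_sum]

/-- First-step decomposition of the probability of an event. -/
lemma measure_eq_tsum (x : S) {A : Set (ℕ → S)} {A' : S → Set (ℕ → S)}
    (hA' : ∀ y, MeasurableSet (A' y)) (h : ∀ f, f ∈ A ↔ shift f ∈ A' (f 1)) :
    C.μ x A = ∑' y, C.trans x y * C.μ y (A' y) := by
  have hB : MeasurableSet {g : ℕ → S | g ∈ A' (g 0)} := by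
    have : {g : ℕ → S | g ∈ A' (g 0)} = ⋃ y, {g | g 0 ∈ ({y} : Set S)} ∩ A' y := by
      ext g; simp
    rw [this]
    exact MeasurableSet.iUnion fun y => (measurableSet_apply_mem 0 {y}).inter (hA' y)
  have : A = shift ⁻¹' {g : ℕ → S | g ∈ A' (g 0)} := by
    ext f; exact h f
  rw [this, ← Measure.map_apply measurable_shift hB, C.map_shift, Measure.sum_apply _ hB]
  refine tsum_congr fun y => ?_
  rw [Measure.smul_apply, smul_eq_mul]
  congr 1
  refine measure_congr ?_
  filter_upwards [C.ae_start y] with g hg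
  change (g ∈ A' (g 0)) = (g ∈ A' y)
  rw [hg]

end Chain

end FirstStep

section Counting

variable {S : Type*}

/-- The number of visits of the trajectory to `A` at the times `1, …, k`. -/
def visitCount (A : Set S) (k : ℕ) (f : ℕ → S) : ℕ :=
  ∑ s ∈ Finset.range k, if f (s + 1) ∈ A then 1 else 0

lemma visitCount_shift (A : Set S) (k : ℕ) (f : ℕ → S) :
    visitCount A (k + 1) f = visitCount A k (shift f) + if f 1 ∈ A then 1 else 0 :=
  Finset.sum_range_succ' _ _

lemma visitCount_mono (A : Set S) (f : ℕ → S) : Monotone fun k => visitCount A k f :=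
  fun _ _ h => Finset.sum_le_sum_of_subset (Finset.range_mono h)

lemma visitCount_le (A : Set S) (k : ℕ) (f : ℕ → S) : visitCount A k f ≤ k := by
  refine (Finset.sum_le_card_nsmul _ _ 1 fun s _ => ?_).trans (by simp)
  split_ifs <;> simp

lemma lt_hit_iff (i : S) (f : ℕ → S) (k : ℕ) :
    (k : ℕ∞) < hit i f ↔ ∀ s < k, f (s + 1) ≠ i := by
  constructor
  · intro h s hs hf
    have h1 : hit i f ≤ ((s + 1 : ℕ) : ℕ∞) := sInf_le ⟨s + 1, rfl, by omega, hf⟩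
    have h2 : (k : ℕ∞) < ((s + 1 : ℕ) : ℕ∞) := h.trans_le h1
    have := Nat.cast_lt.1 h2
    omega
  · intro h
    have : ((k + 1 : ℕ) : ℕ∞) ≤ hit i f := by
      refine le_sInf ?_
      rintro _ ⟨m, rfl, hm, hf⟩
      refine Nat.cast_le.2 ?_
      by_contra hlt
      refine h (m - 1) (by omega) ?_
      rwa [Nat.sub_add_cancel hm]
    exact (Nat.cast_lt.2 (Nat.lt_succ_self k)).trans_le this

lemma hit_eq_top_iff (i : S) (f : ℕ → S) : hit i f = ⊤ ↔ ∀ s, f (s + 1) ≠ i := by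
  constructor
  · intro h s
    exact (lt_hit_iff i f (s + 1)).1 (h ▸ ENat.natCast_lt_top _) s (Nat.lt_succ_self s)
  · intro h
    refine ENat.eq_top_iff_forall_gt.2 fun k => ?_
    exact (lt_hit_iff i f k).2 fun s _ => h s

lemma exists_hit_eq {i : S} {f : ℕ → S} (h : hit i f ≠ ⊤) :
    ∃ t : ℕ, hit i f = ((t + 1 : ℕ) : ℕ∞) ∧ f (t + 1) = i := by
  obtain ⟨T, hT⟩ := ENat.ne_top_iff_exists.1 h
  have hpos : (0 : ℕ) < T := by
    have := (lt_hit_iff i f 0).2 (by simp)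
    rw [← hT] at this
    exact_mod_cast this
  obtain ⟨t, rfl⟩ : ∃ t, T = t + 1 := ⟨T - 1, by omega⟩
  refine ⟨t, hT.symm, ?_⟩
  by_contra hf
  have : ((t + 1 : ℕ) : ℕ∞) < hit i f := by
    refine (lt_hit_iff i f (t + 1)).2 fun s hs => ?_
    rcases Nat.lt_succ_iff_lt_or_eq.1 hs with h1 | rfl
    · refine (lt_hit_iff i f t).1 ?_ s h1
      rw [← hT]
      exact Nat.cast_lt.2 (Nat.lt_succ_self t)
    · exact hf
  rw [← hT] at this
  exact lt_irrefl _ this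

/-- The trajectory visits `A` at least `m` times before returning to `i`,
the first `m` visits taking place up to time `K`. -/
def manyVisits (A : Set S) (i : S) (K m : ℕ) : Set (ℕ → S) :=
  {f | ∃ k ≤ K, m ≤ visitCount A k f ∧ ∀ s < k, f (s + 1) ≠ i}

lemma manyVisits_zero_right (A : Set S) (i : S) (K : ℕ) : manyVisits A i K 0 = Set.univ :=
  Set.eq_univ_of_forall fun _ => ⟨0, Nat.zero_le _, Nat.zero_le _, by simp⟩

lemma manyVisits_zero_succ (A : Set S) (i : S) (m : ℕ) : manyVisits A i 0 (m + 1) = ∅ := by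
  refine Set.eq_empty_of_forall_notMem ?_
  rintro f ⟨k, hk, hm, -⟩
  have := visitCount_le A k f
  omega

lemma manyVisits_mono (A : Set S) (i : S) (m : ℕ) : Monotone fun K => manyVisits A i K m :=
  fun _ _ h _ ⟨k, hk, hf⟩ => ⟨k, hk.trans h, hf⟩

lemma manyVisits_anti (A : Set S) (i : S) (K : ℕ) : Antitone fun m => manyVisits A i K m :=
  fun _ _ h _ ⟨k, hk, hm, hf⟩ => ⟨k, hk, h.trans hm, hf⟩

lemma mem_manyVisits_succ (A : Set S) (i : S) (K m : ℕ) (f : ℕ → S) :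
    f ∈ manyVisits A i (K + 1) (m + 1) ↔
      f 1 ≠ i ∧ shift f ∈ manyVisits A i K (if f 1 ∈ A then m else m + 1) := by
  constructor
  · rintro ⟨k, hk, hm, hf⟩
    cases k with
    | zero => simp [visitCount] at hm
    | succ k =>
      refine ⟨hf 0 (Nat.succ_pos k), k, by omega, ?_, fun s hs => hf (s + 1) (by omega)⟩
      rw [visitCount_shift] at hm
      split_ifs at hm ⊢ <;> omega
  · rintro ⟨h1, k, hk, hm, hf⟩
    refine ⟨k + 1, by omega, ?_, ?_⟩
    · rw [visitCount_shift]
      split_ifs at hm ⊢ <;> omega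
    · rintro (_ | s) hs
      · exact h1
      · exact hf s (by omega)

variable [MeasurableSpace S]

namespace Chain

variable (C : Chain S)

/-- The probability of at least `m` visits to `A` before the return to `i`. -/
def manyVisitsProb (A : Set S) (i : S) (m : ℕ) (x : S) : ℝ≥0∞ :=
  C.μ x (⋃ K, manyVisits A i K m)

lemma manyVisitsProb_le_one (A : Set S) (i : S) (m : ℕ) (x : S) :
    C.manyVisitsProb A i m x ≤ 1 := prob_le_one

lemma manyVisitsProb_anti (A : Set S) (i : S) (x : S) :
    Antitone fun m => C.manyVisitsProb A i m x :=
  fun _ _ h => measure_mono (Set.iUnion_mono fun K => manyVisits_anti A i K h)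

end Chain

variable [MeasurableSingletonClass S] [Countable S]

lemma measurable_visitCount (A : Set S) (k : ℕ) : Measurable (visitCount A k) :=
  Finset.measurable_sum _ fun s _ =>
    Measurable.ite (measurableSet_apply_mem (s + 1) A) measurable_const measurable_const

lemma measurableSet_forall_ne (i : S) (k : ℕ) :
    MeasurableSet {f : ℕ → S | ∀ s < k, f (s + 1) ≠ i} := by
  have : {f : ℕ → S | ∀ s < k, f (s + 1) ≠ i} =
      ⋂ s, ⋂ (_ : s < k), {f | f (s + 1) ∈ ({i}ᶜ : Set S)} := by
    ext f; simp
  rw [this]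
  exact MeasurableSet.iInter fun s => MeasurableSet.iInter fun _ => measurableSet_apply_mem _ _

lemma measurableSet_manyVisits (A : Set S) (i : S) (K m : ℕ) :
    MeasurableSet (manyVisits A i K m) := by
  have : manyVisits A i K m =
      ⋃ k, ⋃ (_ : k ≤ K), {f | m ≤ visitCount A k f} ∩ {f | ∀ s < k, f (s + 1) ≠ i} := by
    ext f; simp [manyVisits, and_left_comm]
  rw [this]
  exact MeasurableSet.iUnion fun k => MeasurableSet.iUnion fun _ =>
    (measurableSet_le measurable_const (measurable_visitCount A k)).inter
      (measurableSet_forall_ne i k)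

lemma measurableSet_hit_eq_top (i : S) : MeasurableSet {f : ℕ → S | hit i f = ⊤} := by
  have : {f : ℕ → S | hit i f = ⊤} = ⋂ k, {f | ∀ s < k, f (s + 1) ≠ i} := by
    ext f
    simp only [Set.mem_ofPred_eq, hit_eq_top_iff, Set.mem_iInter]
    exact ⟨fun h k s _ => h s, fun h s => h (s + 1) s (Nat.lt_succ_self s)⟩
  rw [this]
  exact MeasurableSet.iInter fun k => measurableSet_forall_ne i k

namespace Chain

variable (C : Chain S)

lemma measure_manyVisits_succ (A : Set S) (i : S) (K m : ℕ) (x : S) :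
    C.μ x (manyVisits A i (K + 1) (m + 1)) = ∑' y, C.trans x y *
      if y = i then 0 else C.μ y (manyVisits A i K (if y ∈ A then m else m + 1)) := by
  rw [C.measure_eq_tsum x
    (A' := fun y => if y = i then ∅ else manyVisits A i K (if y ∈ A then m else m + 1))]
  · refine tsum_congr fun y => ?_
    split_ifs <;> simp
  · intro y
    split_ifs
    · exact MeasurableSet.empty
    · exact measurableSet_manyVisits A i K m
    · exact measurableSet_manyVisits A i K (m + 1)
  · intro f
    rw [mem_manyVisits_succ]
    by_cases h : f 1 = i <;> simp [h]

lemma measure_manyVisits_add_le {A : Set S} (i : S) (n : ℕ) {q : ℝ≥0∞}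
    (hq : ∀ j ∈ A, C.manyVisitsProb A i n j ≤ q) (K : ℕ) :
    ∀ (m : ℕ) (x : S), x ∈ A ∨ m ≠ 0 →
      C.μ x (manyVisits A i K (m + n)) ≤ C.μ x (manyVisits A i K m) * q := by
  have zero_case : ∀ (K : ℕ), ∀ x ∈ A,
      C.μ x (manyVisits A i K (0 + n)) ≤ C.μ x (manyVisits A i K 0) * q := by
    intro K x hx
    rw [manyVisits_zero_right, measure_univ, one_mul, zero_add]
    exact (measure_mono (Set.subset_iUnion (fun K => manyVisits A i K n) K)).trans (hq x hx)
  induction K with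
  | zero =>
    rintro (_ | m) x hx
    · exact zero_case 0 x (by simpa using hx)
    · rw [Nat.add_right_comm, manyVisits_zero_succ]
      simp
  | succ K ih =>
    rintro (_ | m) x hx
    · exact zero_case _ x (by simpa using hx)
    · rw [Nat.add_right_comm, measure_manyVisits_succ, measure_manyVisits_succ,
        ← ENNReal.tsum_mul_right]
      refine ENNReal.tsum_le_tsum fun y => ?_
      rw [mul_assoc]
      gcongr
      by_cases hy : y = i
      · simp [hy]
      · by_cases hA : y ∈ A
        · simpa [hy, hA] using ih m y (Or.inl hA)
        · simpa [hy, hA, Nat.add_right_comm] using ih (m + 1) y (Or.inr (Nat.succ_ne_zero m))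

lemma manyVisitsProb_add_le {A : Set S} (i : S) (n : ℕ) {q : ℝ≥0∞}
    (hq : ∀ j ∈ A, C.manyVisitsProb A i n j ≤ q) (m : ℕ) {x : S} (hx : x ∈ A) :
    C.manyVisitsProb A i (m + n) x ≤ C.manyVisitsProb A i m x * q := by
  rw [manyVisitsProb, (manyVisits_mono A i (m + n)).measure_iUnion]
  refine iSup_le fun K => (C.measure_manyVisits_add_le i n hq K m x (Or.inl hx)).trans ?_
  gcongr
  exact measure_mono (Set.subset_iUnion (fun K => manyVisits A i K m) K)

lemma manyVisitsProb_mul_le {A : Set S} (i : S) (n : ℕ) {q : ℝ≥0∞}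
    (hq : ∀ j ∈ A, C.manyVisitsProb A i n j ≤ q) (l : ℕ) {x : S} (hx : x ∈ A) :
    C.manyVisitsProb A i (n * l) x ≤ q ^ l := by
  induction l with
  | zero => simpa using C.manyVisitsProb_le_one A i 0 x
  | succ l ih =>
    rw [Nat.mul_succ, pow_succ]
    refine (C.manyVisitsProb_add_le i n hq (n * l) hx).trans ?_
    gcongr

lemma measure_visitCount_lt_succ (A : Set S) (k m : ℕ) (x : S) :
    C.μ x {f | visitCount A (k + 1) f < m} = ∑' y, C.trans x y *
      C.μ y {f | visitCount A k f + (if y ∈ A then 1 else 0) < m} := by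
  refine C.measure_eq_tsum x (fun y => ?_) fun f => ?_
  · exact measurableSet_lt ((measurable_visitCount A k).add measurable_const) measurable_const
  · simp only [Set.mem_ofPred_eq, visitCount_shift]

/-- If `h ≥ 1` contracts by a factor `c` outside `A`, and `h = 1` on `A`, then few visits to `A`
up to time `k` are exponentially unlikely in `k`. -/
lemma measure_visitCount_lt_le {A : Set S} {h : S → ℝ≥0∞} {D c : ℝ≥0∞}
    (h_one : ∀ x, 1 ≤ h x) (h_mem : ∀ x ∈ A, h x = 1) (hD : 1 ≤ D)
    (h_out : ∀ x ∉ A, ∑' y, C.trans x y * h y ≤ c * h x)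
    (h_in : ∀ x ∈ A, ∑' y, C.trans x y * h y ≤ D * c) (k : ℕ) :
    ∀ (m : ℕ) (x : S), C.μ x {f | visitCount A k f < m + 1} ≤
      D ^ m * c ^ k * if x ∈ A then D else h x := by
  induction k with
  | zero =>
    intro m x
    refine prob_le_one.trans ?_
    rw [pow_zero, mul_one]
    refine one_le_mul (one_le_pow₀ hD) ?_
    split_ifs
    exacts [hD, h_one x]
  | succ k ih =>
    intro m x
    have key : ∀ y, C.μ y {f | visitCount A k f + (if y ∈ A then 1 else 0) < m + 1} ≤
        D ^ m * c ^ k * h y := by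
      intro y
      by_cases hy : y ∈ A
      · simp only [hy, if_true, h_mem y hy, mul_one, Nat.add_lt_add_iff_right]
        cases m with
        | zero => simp
        | succ m =>
          refine (ih m y).trans (le_of_eq ?_)
          rw [if_pos hy, pow_succ]
          ring
      · simpa [hy] using ih m y
    rw [measure_visitCount_lt_succ]
    calc _ ≤ ∑' y, C.trans x y * (D ^ m * c ^ k * h y) :=
          ENNReal.tsum_le_tsum fun y => mul_le_mul_right (key y) _
      _ = D ^ m * c ^ k * ∑' y, C.trans x y * h y := by
          rw [← ENNReal.tsum_mul_left]
          exact tsum_congr fun y => by ring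
      _ ≤ D ^ m * c ^ k * (c * if x ∈ A then D else h x) := by
          gcongr
          split_ifs with hx
          · rw [mul_comm]; exact h_in x hx
          · exact h_out x hx
      _ = _ := by rw [pow_succ]; ring

end Chain

end Counting

lemma exp_le_one_add_add_sq {z : ℝ} (h1 : -1 ≤ z) (h2 : z ≤ 1) :
    Real.exp z ≤ 1 + z + (Real.exp 1 - 2) * z ^ 2 := by
  have hz : HasSum (fun n : ℕ => z ^ n / (n.factorial : ℝ)) (Real.exp z) := by
    rw [Real.exp_eq_exp_ℝ]
    exact NormedSpace.expSeries_div_hasSum_exp z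
  have he : HasSum (fun n : ℕ => (1 : ℝ) ^ n / (n.factorial : ℝ)) (Real.exp 1) := by
    rw [Real.exp_eq_exp_ℝ]
    exact NormedSpace.expSeries_div_hasSum_exp 1
  have hz2 := (hasSum_nat_add_iff' 2).2 hz
  have he2 := ((hasSum_nat_add_iff' 2).2 he).mul_left (z ^ 2)
  have hsq : ∀ n : ℕ, z ^ (n + 2) ≤ z ^ 2 := fun n => by
    rw [pow_add]
    refine mul_le_of_le_one_left (sq_nonneg z) ?_
    refine (le_abs_self _).trans ?_
    rw [abs_pow]
    exact pow_le_one₀ (abs_nonneg z) (abs_le.2 ⟨h1, h2⟩)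
  have := hasSum_le (fun n => ?_) hz2 he2
  · norm_num [Finset.sum_range_succ] at this
    linarith
  · rw [one_pow, mul_one_div]
    exact div_le_div_of_nonneg_right (hsq n) (Nat.cast_nonneg _)

namespace Chain

variable {S : Type*} [MeasurableSpace S] (C : Chain S)

lemma trans_ne_top (x y : S) : C.trans x y ≠ ⊤ :=
  ENNReal.ne_top_of_tsum_ne_top (by rw [C.trans_sum x]; exact ENNReal.one_ne_top) y

lemma hasSum_trans_toReal (x : S) : HasSum (fun y => (C.trans x y).toReal) 1 := by
  have h := ENNReal.summable_toReal (f := C.trans x) (by rw [C.trans_sum x]; exact ENNReal.one_ne_top)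
  have := h.hasSum
  rwa [← ENNReal.tsum_toReal_eq (C.trans_ne_top x), C.trans_sum x, ENNReal.toReal_one] at this

end Chain

namespace LyapunovData

variable {S : Type*} [MeasurableSpace S] {C : Chain S} (L : LyapunovData C)

/-- The exponential decay rate of the length of an excursion away from `B`. -/
def rate : ℝ := 0.8 * (1 - L.rho) / Real.exp (L.eta * L.nuMax)

/-- The time budget allotted to each visit to `B`. -/
def cost : ℝ := 1.25 * Real.exp (2 * L.eta * L.nuMax) /
  ((1 - L.rho) * (Real.exp (L.eta * L.nuMax) - L.rho)) + 1

lemma exp_one_sub_two_gt : 0.718 < Real.exp 1 - 2 := by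
  have := Real.exp_one_gt_d9
  norm_num at this ⊢
  linarith

lemma exp_one_sub_two_lt : Real.exp 1 - 2 < 0.719 := by
  have := Real.exp_one_lt_d9
  norm_num at this ⊢
  linarith

lemma eta_pos : 0 < L.eta := by
  have := exp_one_sub_two_gt
  have h1 := L.nuMax_pos
  have h2 := L.gam_pos
  have h3 : 0 < Real.exp 1 - 2 := by linarith
  unfold eta
  positivity

lemma eta_mul_nuMax_pos : 0 < L.eta * L.nuMax := mul_pos L.eta_pos L.nuMax_pos

lemma gam_eq : L.gam = 2 * (Real.exp 1 - 2) * L.nuMax * (L.eta * L.nuMax) := by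
  have := exp_one_sub_two_gt
  have h1 := L.nuMax_pos
  have h3 : Real.exp 1 - 2 ≠ 0 := by linarith
  unfold eta
  field_simp

lemma rho_eq : L.rho = 1 - (Real.exp 1 - 2) * (L.eta * L.nuMax) ^ 2 := by
  have := exp_one_sub_two_gt
  have h1 := L.nuMax_pos
  have h3 : Real.exp 1 - 2 ≠ 0 := by linarith
  unfold rho eta
  field_simp
  ring

lemma rho_lt_one : L.rho < 1 := by
  have := exp_one_sub_two_gt
  have := L.eta_mul_nuMax_pos
  rw [rho_eq]
  have : 0 < (Real.exp 1 - 2) * (L.eta * L.nuMax) ^ 2 := mul_pos (by linarith) (by positivity)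
  linarith

lemma rate_pos : 0 < L.rate := by
  have := L.rho_lt_one
  unfold rate
  exact div_pos (by linarith) (Real.exp_pos _)

lemma one_lt_exp : 1 < Real.exp (L.eta * L.nuMax) := Real.one_lt_exp_iff.2 L.eta_mul_nuMax_pos

lemma rho_le_exp_neg_rate : L.rho ≤ Real.exp (-L.rate) := by
  have h1 := L.rho_lt_one
  have h2 := L.one_lt_exp
  have h3 : L.rate ≤ 1 - L.rho := by
    unfold rate
    rw [div_le_iff₀ (Real.exp_pos _)]
    nlinarith
  have := Real.add_one_le_exp (-L.rate)
  linarith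

lemma rate_mul_cost : L.rate * L.cost =
    Real.exp (L.eta * L.nuMax) / (Real.exp (L.eta * L.nuMax) - L.rho) + L.rate := by
  have h1 : 1 - L.rho ≠ 0 := by have := L.rho_lt_one; linarith
  have h2 : Real.exp (L.eta * L.nuMax) - L.rho ≠ 0 := by
    have := L.rho_lt_one; have := L.one_lt_exp; linarith
  have h3 : Real.exp (2 * L.eta * L.nuMax) = Real.exp (L.eta * L.nuMax) ^ 2 := by
    rw [← Real.exp_nat_mul]; congr 1; push_cast; ring
  have h4 := (Real.exp_pos (L.eta * L.nuMax)).ne'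
  rw [cost, mul_add, mul_one, h3]
  congr 1
  unfold rate
  field_simp
  norm_num

lemma cost_gt_one : 1 < L.cost := by
  have := L.rho_lt_one
  have := L.one_lt_exp
  have : 0 < 1.25 * Real.exp (2 * L.eta * L.nuMax) /
      ((1 - L.rho) * (Real.exp (L.eta * L.nuMax) - L.rho)) :=
    div_pos (by positivity) (mul_pos (by linarith) (by linarith))
  unfold cost
  linarith

lemma R_eq (i : S) : L.R i = 2 * L.HB i * L.cost + Real.log 2 / L.rate := by
  unfold R cost rate
  congr 1
  rw [div_div_eq_mul_div]

lemma abs_sub_mul_le (x y : S) :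
    |(C.trans x y).toReal * (L.V y - L.V x)| ≤ L.nuMax * (C.trans x y).toReal := by
  rw [abs_mul, abs_of_nonneg ENNReal.toReal_nonneg, mul_comm]
  by_cases h : C.trans x y = 0
  · simp [h]
  · exact mul_le_mul_of_nonneg_right (L.bounded_jump x y h) ENNReal.toReal_nonneg

lemma summable_drift (x : S) :
    Summable fun y => (C.trans x y).toReal * (L.V y - L.V x) :=
  Summable.of_norm_bounded ((C.hasSum_trans_toReal x).summable.mul_left L.nuMax)
    (L.abs_sub_mul_le x)

lemma gam_lt_nuMax {x : S} (hx : x ∉ L.B) : L.gam < L.nuMax := by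
  have h1 := L.drift x (not_le.1 hx)
  have h2 := hasSum_le (fun y => (abs_le.1 (L.abs_sub_mul_le x y)).1)
    ((C.hasSum_trans_toReal x).mul_left L.nuMax).neg (L.summable_drift x).hasSum
  linarith

lemma eta_mul_nuMax_lt {x : S} (hx : x ∉ L.B) :
    2 * (Real.exp 1 - 2) * (L.eta * L.nuMax) < 1 := by
  have h1 := L.gam_lt_nuMax hx
  rw [L.gam_eq] at h1
  have := L.nuMax_pos
  by_contra h
  nlinarith

lemma tsum_exp_le {x : S} (hx : x ∉ L.B) :
    ∑' y, C.trans x y * ENNReal.ofReal (Real.exp (L.eta * (L.V y - L.V x))) ≤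
      ENNReal.ofReal L.rho := by
  have hc := exp_one_sub_two_gt
  have hη := L.eta_pos
  have ha := L.eta_mul_nuMax_lt hx
  have ha1 : L.eta * L.nuMax ≤ 1 := by nlinarith [L.eta_mul_nuMax_pos]
  set K := (Real.exp 1 - 2) * (L.eta * L.nuMax) ^ 2 with hK
  have hbound : ∀ y, C.trans x y ≠ 0 →
      Real.exp (L.eta * (L.V y - L.V x)) ≤ 1 + L.eta * (L.V y - L.V x) + K := by
    intro y hy
    have h := L.bounded_jump x y hy
    have h' : |L.eta * (L.V y - L.V x)| ≤ L.eta * L.nuMax := by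
      rw [abs_mul, abs_of_pos hη]
      exact mul_le_mul_of_nonneg_left h hη.le
    obtain ⟨hl, hu⟩ := abs_le.1 h'
    refine (exp_le_one_add_add_sq (by linarith) (by linarith)).trans ?_
    have : (L.eta * (L.V y - L.V x)) ^ 2 ≤ (L.eta * L.nuMax) ^ 2 := sq_le_sq' hl hu
    have := mul_le_mul_of_nonneg_left this (by linarith : 0 ≤ Real.exp 1 - 2)
    linarith
  set g : S → ℝ := fun y => (C.trans x y).toReal * (1 + L.eta * (L.V y - L.V x) + K) with hg
  have hterm : ∀ y, (C.trans x y).toReal * Real.exp (L.eta * (L.V y - L.V x)) ≤ g y := by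
    intro y
    by_cases hy : C.trans x y = 0
    · simp [hg, hy]
    · exact mul_le_mul_of_nonneg_left (hbound y hy) ENNReal.toReal_nonneg
  have hsum : HasSum g (1 * (1 + K) +
      L.eta * ∑' y, (C.trans x y).toReal * (L.V y - L.V x)) := by
    refine (((C.hasSum_trans_toReal x).mul_right (1 + K)).add
      ((L.summable_drift x).hasSum.mul_left L.eta)).congr_fun ?_
    intro y
    simp only [hg]
    ring
  calc _ ≤ ∑' y, ENNReal.ofReal (g y) := by
        refine ENNReal.tsum_le_tsum fun y => ?_
        conv_lhs => rw [← ENNReal.ofReal_toReal (C.trans_ne_top x y)]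
        rw [← ENNReal.ofReal_mul ENNReal.toReal_nonneg]
        exact ENNReal.ofReal_le_ofReal (hterm y)
    _ = ENNReal.ofReal (∑' y, g y) :=
        (ENNReal.ofReal_tsum_of_nonneg (fun y => le_trans (by positivity) (hterm y))
          hsum.summable).symm
    _ ≤ ENNReal.ofReal L.rho := by
        refine ENNReal.ofReal_le_ofReal ?_
        rw [hsum.tsum_eq, rho_eq]
        have hd := mul_le_mul_of_nonneg_left (L.drift x (not_le.1 hx)).le hη.le
        have : L.eta * L.gam = 2 * K := by rw [L.gam_eq, hK]; ring
        linarith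

/-- An exponential of `V` outside `B`, and `1` on `B`. -/
def expV (x : S) : ℝ≥0∞ :=
  if x ∈ L.B then 1 else ENNReal.ofReal (Real.exp (L.eta * (L.V x - L.b + L.nuMax)))

lemma expV_mem {x : S} (hx : x ∈ L.B) : L.expV x = 1 := if_pos hx

lemma one_le_expV (x : S) : 1 ≤ L.expV x := by
  unfold expV
  split_ifs with h
  · exact le_rfl
  · rw [ENNReal.one_le_ofReal]
    have : L.b < L.V x := not_le.1 h
    exact Real.one_le_exp (mul_nonneg L.eta_pos.le (by linarith [L.nuMax_pos]))

lemma tsum_expV_le {x : S} (hx : x ∉ L.B) :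
    ∑' y, C.trans x y * L.expV y ≤ ENNReal.ofReal (Real.exp (-L.rate)) * L.expV x := by
  have hle : ∀ y, C.trans x y * L.expV y ≤ C.trans x y *
      ENNReal.ofReal (Real.exp (L.eta * (L.V y - L.V x))) * L.expV x := by
    intro y
    have hmul : ENNReal.ofReal (Real.exp (L.eta * (L.V y - L.V x))) * L.expV x =
        ENNReal.ofReal (Real.exp (L.eta * (L.V y - L.b + L.nuMax))) := by
      rw [expV, if_neg hx, ← ENNReal.ofReal_mul (Real.exp_pos _).le, ← Real.exp_add]
      congr 2
      ring
    rw [mul_assoc, hmul]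
    by_cases hy : C.trans x y = 0
    · simp [hy]
    · gcongr
      rw [expV]
      split_ifs
      · have h1 : L.b < L.V x := not_le.1 hx
        have h2 := (abs_le.1 (L.bounded_jump x y hy)).1
        rw [ENNReal.one_le_ofReal]
        exact Real.one_le_exp (mul_nonneg L.eta_pos.le (by linarith))
      · exact le_rfl
  refine (ENNReal.tsum_le_tsum hle).trans ?_
  rw [ENNReal.tsum_mul_right]
  gcongr
  exact (L.tsum_exp_le hx).trans (ENNReal.ofReal_le_ofReal L.rho_le_exp_neg_rate)

lemma tsum_expV_le_of_mem {x : S} (hx : x ∈ L.B) :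
    ∑' y, C.trans x y * L.expV y ≤ ENNReal.ofReal (Real.exp (2 * (L.eta * L.nuMax))) := by
  refine (ENNReal.tsum_le_tsum (g := fun y => C.trans x y *
    ENNReal.ofReal (Real.exp (2 * (L.eta * L.nuMax)))) fun y => ?_).trans ?_
  · by_cases hy : C.trans x y = 0
    · simp [hy]
    · gcongr
      rw [expV]
      split_ifs
      · rw [ENNReal.one_le_ofReal]
        exact Real.one_le_exp (by linarith [L.eta_mul_nuMax_pos])
      · refine ENNReal.ofReal_le_ofReal (Real.exp_le_exp.2 ?_)
        have h1 : L.V x ≤ L.b := hx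
        have h2 := (abs_le.1 (L.bounded_jump x y hy)).2
        have : L.eta * (L.V y - L.b + L.nuMax) ≤ L.eta * (2 * L.nuMax) :=
          mul_le_mul_of_nonneg_left (by linarith) L.eta_pos.le
        linarith
  · rw [ENNReal.tsum_mul_right, C.trans_sum, one_mul]

lemma two_mul_le_div {x : S} (hx : x ∉ L.B) : 2 * (L.eta * L.nuMax) ≤
    Real.exp (L.eta * L.nuMax) / (Real.exp (L.eta * L.nuMax) - L.rho) := by
  have h1 := L.rho_lt_one
  have h2 := L.one_lt_exp
  rw [le_div_iff₀ (by linarith)]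
  have hc := exp_one_sub_two_gt
  have hc' := exp_one_sub_two_lt
  have ha := L.eta_mul_nuMax_lt hx
  have ha0 := L.eta_mul_nuMax_pos
  rw [rho_eq]
  set a := L.eta * L.nuMax
  set c := Real.exp 1 - 2
  have ha1 : a ≤ 0.7 := by nlinarith
  have hexp : Real.exp a ≤ 2.06 := by
    have := exp_le_one_add_add_sq (z := a) (by linarith) (by norm_num at ha1 ⊢; linarith)
    have : c * a ^ 2 ≤ 0.36 := by
      have : a ^ 2 ≤ 0.49 := by norm_num at ha1 ⊢; nlinarith
      norm_num at hc hc' this ⊢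
      nlinarith
    norm_num at ha1 this ⊢
    linarith
  have hρ : 1 - a / 2 ≤ 1 - c * a ^ 2 := by nlinarith
  suffices (2 * a - 1) * Real.exp a ≤ 2 * a * (1 - a / 2) by nlinarith
  norm_num at ha1 hexp
  rcases le_total a (1 / 2) with h | h
  · nlinarith [Real.exp_pos a]
  · nlinarith [mul_le_mul_of_nonneg_left hexp (by linarith : 0 ≤ 2 * a - 1)]

/-- The logarithm of the growth factor per visit to `B` of the bound on the exponential moment of
the visit times. -/
lemma exists_growth : ∃ d : ℝ, 0 ≤ d ∧ d ≤ L.rate * L.cost ∧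
    ∀ x ∈ L.B, ∑' y, C.trans x y * L.expV y ≤
      ENNReal.ofReal (Real.exp d) * ENNReal.ofReal (Real.exp (-L.rate)) := by
  by_cases h : ∃ x, x ∉ L.B
  · obtain ⟨x, hx⟩ := h
    refine ⟨2 * (L.eta * L.nuMax) + L.rate, ?_, ?_, fun y hy => ?_⟩
    · linarith [L.eta_mul_nuMax_pos, L.rate_pos]
    · rw [rate_mul_cost]
      linarith [L.two_mul_le_div hx]
    · rw [← ENNReal.ofReal_mul (Real.exp_pos _).le, ← Real.exp_add, add_neg_cancel_right]
      exact L.tsum_expV_le_of_mem hy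
  · push Not at h
    refine ⟨L.rate, L.rate_pos.le, ?_, fun y _ => ?_⟩
    · nlinarith [L.cost_gt_one, L.rate_pos]
    · rw [← ENNReal.ofReal_mul (Real.exp_pos _).le, ← Real.exp_add, add_neg_cancel]
      simp [L.expV_mem (h _), C.trans_sum]

end LyapunovData

lemma tsum_ne_top_of_add_le {u : ℕ → ℝ≥0∞} (hu : ∀ m, u m ≤ 1) {N : ℕ} {q : ℝ≥0∞} (hq : q < 1)
    (h : ∀ m, u (m + N) ≤ u m * q) : ∑' m, u m ≠ ⊤ := by
  have hbound : ∀ n, ∑ m ∈ Finset.range n, u m ≤ N / (1 - q) := by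
    intro n
    have hcard : ∀ n, ∑ m ∈ Finset.range n, u m ≤ n := fun n => by
      simpa using Finset.sum_le_card_nsmul (Finset.range n) u 1 fun m _ => hu m
    have hfin : ∑ m ∈ Finset.range n, u m ≠ ⊤ :=
      ((hcard n).trans_lt (ENNReal.natCast_lt_top n)).ne
    have hstep : ∑ m ∈ Finset.range n, u m ≤ N + (∑ m ∈ Finset.range n, u m) * q := by
      calc _ ≤ ∑ m ∈ Finset.range (N + n), u m :=
            Finset.sum_le_sum_of_subset (Finset.range_mono (Nat.le_add_left n N))
        _ = ∑ m ∈ Finset.range N, u m + ∑ m ∈ Finset.range n, u (N + m) :=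
            Finset.sum_range_add u N n
        _ ≤ N + (∑ m ∈ Finset.range n, u m) * q := by
            refine add_le_add (hcard N) ?_
            rw [Finset.sum_mul]
            exact Finset.sum_le_sum fun m _ => add_comm N m ▸ h m
    rw [ENNReal.le_div_iff_mul_le (Or.inl (tsub_pos_of_lt hq).ne')
      (Or.inl (ENNReal.sub_ne_top ENNReal.one_ne_top)), ENNReal.mul_sub fun _ _ => hfin, mul_one]
    exact tsub_le_iff_right.2 hstep
  refine ne_top_of_le_ne_top ?_ (ENNReal.tsum_le_of_sum_range_le hbound)
  exact ENNReal.div_ne_top (ENNReal.natCast_ne_top N) (tsub_pos_of_lt hq).ne'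

lemma tsum_indicator_lt_nat (n : ℕ) :
    ∑' m : ℕ, (if m < n then (1 : ℝ≥0∞) else 0) = n := by
  rw [tsum_eq_sum (s := Finset.range n) (fun m hm => if_neg (by simpa using hm)),
    Finset.sum_congr rfl fun m hm => if_pos (Finset.mem_range.1 hm)]
  simp

section WatchedChain

variable {S : Type*} [MeasurableSpace S] {C : Chain S} (L : LyapunovData C)

namespace LyapunovData

lemma watchCount_eq (i : S) (f : ℕ → S) :
    L.watchCount i f = visitCount L.B (hit i f).toNat f := by
  rw [watchCount, visitCount, Finset.card_filter, Finset.range_eq_Ico,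
    Finset.sum_Ico_add' (fun s => if f s ∈ L.B then 1 else 0) 0 _ 1]
  rfl

lemma lt_watchCount_iff {i : S} (hi : i ∈ L.B) (m : ℕ) (f : ℕ → S) :
    m < L.watchCount i f ↔ f ∈ (⋃ K, manyVisits L.B i K m) ∧ hit i f ≠ ⊤ := by
  rw [watchCount_eq]
  by_cases h : hit i f = ⊤
  · simp [h, visitCount]
  obtain ⟨t, ht, hf⟩ := exists_hit_eq h
  have hcount : visitCount L.B (hit i f).toNat f = visitCount L.B t f + 1 := by
    rw [ht, ENat.toNat_natCast, visitCount, Finset.sum_range_succ, hf, if_pos hi, visitCount]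
  rw [hcount, Nat.lt_succ_iff, and_iff_left h, Set.mem_iUnion]
  constructor
  · intro hm
    refine ⟨t, t, le_rfl, hm, (lt_hit_iff i f t).1 ?_⟩
    rw [ht]
    exact Nat.cast_lt.2 (Nat.lt_succ_self t)
  · rintro ⟨K, k, -, hm, hk⟩
    refine hm.trans (visitCount_mono L.B f ?_)
    by_contra hlt
    exact hk t (by omega) hf

lemma integral_watchCount_le_HB (i : S) {x : S} (hx : x ∈ L.B) :
    ∫ f, (L.watchCount i f : ℝ) ∂C.μ x ≤ L.HB i := by
  have : Finite L.B := L.finiteB.to_subtype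
  exact le_ciSup (f := fun j : L.B => ∫ f, (L.watchCount i f : ℝ) ∂C.μ (j : S))
    (Set.finite_range _).bddAbove ⟨x, hx⟩

end LyapunovData

variable [MeasurableSingletonClass S] [Countable S]

lemma Chain.Irreducible.exists_return (hirr : C.Irreducible) (j i : S) :
    ∃ n : ℕ, C.μ j {f | f (n + 1) = i} ≠ 0 := by
  obtain ⟨y, hy⟩ : ∃ y, C.trans j y ≠ 0 := by
    by_contra! h
    have := C.trans_sum j
    simp [h] at this
  obtain ⟨n, hn⟩ := hirr y i
  refine ⟨n, ?_⟩
  rw [C.measure_eq_tsum j (A := {f | f (n + 1) = i}) (A' := fun _ => {f | f n = i})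
    (fun _ => measurableSet_apply_mem n {i}) fun f => Iff.rfl]
  exact fun h => mul_ne_zero hy hn.ne' (ENNReal.tsum_eq_zero.1 h y)

namespace LyapunovData

lemma exists_manyVisitsProb_lt_one (hirr : C.Irreducible) (i : S) :
    ∃ N : ℕ, ∃ q < (1 : ℝ≥0∞), ∀ j ∈ L.B, C.manyVisitsProb L.B i N j ≤ q := by
  choose n hn using fun j => hirr.exists_return j i
  have hlt : ∀ j, C.manyVisitsProb L.B i (n j + 1) j < 1 := by
    intro j
    have hmeas : MeasurableSet {f : ℕ → S | f (n j + 1) = i} :=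
      measurableSet_apply_mem (n j + 1) {i}
    have hsub : (⋃ K, manyVisits L.B i K (n j + 1)) ⊆ {f : ℕ → S | f (n j + 1) = i}ᶜ := by
      refine Set.iUnion_subset fun K => ?_
      rintro f ⟨k, -, hk, hf⟩
      exact hf (n j) (Nat.lt_of_succ_le (hk.trans (visitCount_le L.B k f)))
    refine (measure_mono hsub).trans_lt ?_
    rw [prob_compl_eq_one_sub hmeas]
    exact ENNReal.sub_lt_self ENNReal.one_ne_top one_ne_zero (hn j)
  let F : Finset S := L.finiteB.toFinset
  have hF : ∀ j ∈ L.B, j ∈ F := fun j hj => L.finiteB.mem_toFinset.2 hj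
  refine ⟨F.sup fun j => n j + 1,
    F.sup fun j => C.manyVisitsProb L.B i (F.sup fun j => n j + 1) j, ?_, fun j hj => ?_⟩
  · refine (Finset.sup_lt_iff (by simp)).2 fun j hj => ?_
    exact (C.manyVisitsProb_anti L.B i j (Finset.le_sup (f := fun j => n j + 1) hj)).trans_lt
      (hlt j)
  · exact Finset.le_sup (f := fun j => C.manyVisitsProb L.B i (F.sup fun j => n j + 1) j) (hF j hj)

lemma measure_lt_hit_le (i : S) {x : S} (hx : x ∈ L.B) {d : ℝ} (hd : 0 ≤ d)
    (hgrowth : ∀ x ∈ L.B, ∑' y, C.trans x y * L.expV y ≤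
      ENNReal.ofReal (Real.exp d) * ENNReal.ofReal (Real.exp (-L.rate))) (m k : ℕ) :
    C.μ x {f | (k : ℕ∞) < hit i f} ≤ C.manyVisitsProb L.B i m x +
      ENNReal.ofReal (Real.exp d) ^ m * ENNReal.ofReal (Real.exp (-L.rate)) ^ k := by
  have hsub : {f | (k : ℕ∞) < hit i f} ⊆
      (⋃ K, manyVisits L.B i K m) ∪ {f | visitCount L.B k f < m} := by
    intro f hf
    rcases le_or_gt m (visitCount L.B k f) with h | h
    · exact Or.inl (Set.mem_iUnion.2 ⟨k, k, le_rfl, h, (lt_hit_iff i f k).1 hf⟩)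
    · exact Or.inr h
  refine (measure_mono hsub).trans ((measure_union_le _ _).trans ?_)
  refine add_le_add le_rfl ?_
  cases m with
  | zero => simp
  | succ m =>
    have hD : 1 ≤ ENNReal.ofReal (Real.exp d) := by
      rw [ENNReal.one_le_ofReal]
      exact Real.one_le_exp hd
    refine (C.measure_visitCount_lt_le L.one_le_expV (fun _ => L.expV_mem) hD
      (fun _ => L.tsum_expV_le) hgrowth k m x).trans (le_of_eq ?_)
    rw [if_pos hx, pow_succ]
    ring

lemma measure_hit_eq_top (hirr : C.Irreducible) (i : S) {x : S} (hx : x ∈ L.B) :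
    C.μ x {f | hit i f = ⊤} = 0 := by
  obtain ⟨d, hd, -, hgrowth⟩ := L.exists_growth
  obtain ⟨N, q, hq, hN⟩ := L.exists_manyVisitsProb_lt_one hirr i
  have hc : ENNReal.ofReal (Real.exp (-L.rate)) < 1 := by
    rw [ENNReal.ofReal_lt_one]
    exact Real.exp_lt_one_iff.2 (neg_lt_zero.2 L.rate_pos)
  have hle : ∀ m, C.μ x {f | hit i f = ⊤} ≤ C.manyVisitsProb L.B i m x := by
    intro m
    have hlim : Filter.Tendsto (fun k : ℕ => C.manyVisitsProb L.B i m x +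
        ENNReal.ofReal (Real.exp d) ^ m * ENNReal.ofReal (Real.exp (-L.rate)) ^ k)
        Filter.atTop (nhds (C.manyVisitsProb L.B i m x + ENNReal.ofReal (Real.exp d) ^ m * 0)) :=
      (ENNReal.Tendsto.const_mul (ENNReal.tendsto_pow_atTop_nhds_zero_of_lt_one hc)
        (Or.inr (ENNReal.pow_ne_top ENNReal.ofReal_ne_top))).const_add _
    rw [mul_zero, add_zero] at hlim
    refine ge_of_tendsto' hlim fun k => ?_
    refine le_trans (measure_mono fun f hf => ?_) (L.measure_lt_hit_le i hx hd hgrowth m k)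
    change (k : ℕ∞) < hit i f
    rw [show hit i f = ⊤ from hf]
    exact ENat.natCast_lt_top k
  refine le_antisymm (ge_of_tendsto' (ENNReal.tendsto_pow_atTop_nhds_zero_of_lt_one hq)
    fun l => ?_) zero_le
  exact (hle (N * l)).trans (C.manyVisitsProb_mul_le i N hN l hx)

lemma measurableSet_lt_watchCount {i : S} (hi : i ∈ L.B) (m : ℕ) :
    MeasurableSet {f | m < L.watchCount i f} := by
  have : {f | m < L.watchCount i f} =
      (⋃ K, manyVisits L.B i K m) ∩ {f | hit i f = ⊤}ᶜ := by
    ext f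
    exact L.lt_watchCount_iff hi m f
  rw [this]
  exact (MeasurableSet.iUnion fun K => measurableSet_manyVisits _ _ _ _).inter
    (measurableSet_hit_eq_top i).compl

lemma measurable_watchCount {i : S} (hi : i ∈ L.B) : Measurable (L.watchCount i) :=
  measurable_of_Ioi fun m => L.measurableSet_lt_watchCount hi m

lemma measure_lt_watchCount (hirr : C.Irreducible) {i : S} (hi : i ∈ L.B) {x : S} (hx : x ∈ L.B)
    (m : ℕ) : C.μ x {f | m < L.watchCount i f} = C.manyVisitsProb L.B i m x := by
  have h : ∀ᵐ f ∂C.μ x, hit i f ≠ ⊤ := by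
    rw [ae_iff]
    simpa using L.measure_hit_eq_top hirr i hx
  refine measure_congr ?_
  filter_upwards [h] with f hf
  exact propext ((L.lt_watchCount_iff hi m f).trans (and_iff_left hf))

lemma integrable_watchCount (hirr : C.Irreducible) {i : S} (hi : i ∈ L.B) {x : S}
    (hx : x ∈ L.B) : Integrable (fun f => (L.watchCount i f : ℝ)) (C.μ x) := by
  refine ⟨((measurable_from_nat (f := fun n : ℕ => (n : ℝ))).comp
    (L.measurable_watchCount hi)).aestronglyMeasurable, ?_⟩
  rw [hasFiniteIntegral_iff_ofReal (Filter.Eventually.of_forall fun f => Nat.cast_nonneg _)]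
  obtain ⟨N, q, hq, hN⟩ := L.exists_manyVisitsProb_lt_one hirr i
  have hmeas := L.measurableSet_lt_watchCount hi
  calc ∫⁻ f, ENNReal.ofReal (L.watchCount i f : ℝ) ∂C.μ x
      = ∫⁻ f, ∑' m : ℕ, (if m < L.watchCount i f then (1 : ℝ≥0∞) else 0) ∂C.μ x := by
        simp_rw [tsum_indicator_lt_nat, ENNReal.ofReal_natCast]
    _ = ∑' m : ℕ, ∫⁻ f, (if m < L.watchCount i f then (1 : ℝ≥0∞) else 0) ∂C.μ x :=
        lintegral_tsum fun m =>
          (Measurable.ite (hmeas m) measurable_const measurable_const).aemeasurable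
    _ = ∑' m, C.manyVisitsProb L.B i m x := by
        refine tsum_congr fun m => ?_
        rw [← L.measure_lt_watchCount hirr hi hx, ← lintegral_indicator_one (hmeas m)]
        refine lintegral_congr fun f => ?_
        by_cases h : m < L.watchCount i f <;> simp [h]
    _ < ⊤ := lt_top_iff_ne_top.2 (tsum_ne_top_of_add_le
        (fun m => C.manyVisitsProb_le_one _ _ _ _) hq
        fun m => C.manyVisitsProb_add_le i N hN m hx)

lemma manyVisitsProb_floor_le (hirr : C.Irreducible) {i : S} (hi : i ∈ L.B) {x : S}
    (hx : x ∈ L.B) : C.manyVisitsProb L.B i ⌊2 * L.HB i⌋₊ x ≤ 2⁻¹ := by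
  set n := ⌊2 * L.HB i⌋₊
  have h1 := mul_meas_ge_le_integral_of_nonneg (μ := C.μ x)
    (Filter.Eventually.of_forall fun f => Nat.cast_nonneg (L.watchCount i f))
    (L.integrable_watchCount hirr hi hx) ((n : ℝ) + 1)
  have hset : {f | (n : ℝ) + 1 ≤ (L.watchCount i f : ℝ)} = {f | n < L.watchCount i f} := by
    ext f
    change (n : ℝ) + 1 ≤ (L.watchCount i f : ℝ) ↔ n < L.watchCount i f
    rw [← Nat.cast_succ, Nat.cast_le, Nat.succ_le_iff]
  rw [hset, Measure.real, L.measure_lt_watchCount hirr hi hx] at h1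
  have h2 := L.integral_watchCount_le_HB i hx
  have h3 : 2 * L.HB i < n + 1 := Nat.lt_floor_add_one _
  have hfin : C.manyVisitsProb L.B i n x ≠ ⊤ :=
    ne_top_of_le_ne_top ENNReal.one_ne_top (C.manyVisitsProb_le_one _ _ _ _)
  rw [← ENNReal.toReal_le_toReal hfin (by simp), ENNReal.toReal_inv, ENNReal.toReal_ofNat]
  have hn : (0 : ℝ) < (n : ℝ) + 1 := by positivity
  by_contra! h
  nlinarith

end LyapunovData

end WatchedChain

/-- Lemma 15 of the paper. For a chain satisfying Assumption L and any
state `i ∈ B`, the return-time tail satisfies `P_i(T_i > k) ≤ 4 · 2^{−k/R_i}`. -/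
theorem statement17 {S : Type*} [MeasurableSpace S] [MeasurableSingletonClass S] [Countable S]
    (C : Chain S) (hirr : C.Irreducible) (L : LyapunovData C)
    (i : S) (hi : i ∈ L.B) (k : ℕ) (hk : 1 ≤ k) :
    C.tailP i k ≤ 4 * (2 : ℝ) ^ (-(k : ℝ) / L.R i) := by
  have hr := L.rate_pos
  have hA := L.cost_gt_one
  have hH : 0 ≤ L.HB i :=
    (integral_nonneg fun f => Nat.cast_nonneg _).trans (L.integral_watchCount_le_HB i hi)
  have hlog : 0 < Real.log 2 := Real.log_pos one_lt_two
  have hR : 0 < L.R i := by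
    rw [L.R_eq]
    positivity
  obtain ⟨d, hd, hdle, hgrowth⟩ := L.exists_growth
  set t : ℝ := k / L.R i with ht
  have ht0 : 0 ≤ t := by positivity
  have hkt : (k : ℝ) = t * L.R i := by rw [ht]; field_simp
  set n := ⌊2 * L.HB i⌋₊
  set l := ⌊t⌋₊
  have hn : (n : ℝ) ≤ 2 * L.HB i := Nat.floor_le (by positivity)
  have hl : (l : ℝ) ≤ t := Nat.floor_le ht0
  have hl' : t < l + 1 := Nat.lt_floor_add_one t
  have hpow : ∀ s : ℝ, (2 : ℝ) ^ s = Real.exp (Real.log 2 * s) :=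
    fun s => Real.rpow_def_of_pos two_pos s
  have hfew : d * ↑(n * l) - L.rate * k ≤ Real.log 2 * (-t) := by
    have h1 : (↑(n * l) : ℝ) ≤ 2 * L.HB i * t := by
      push_cast
      exact mul_le_mul hn hl (Nat.cast_nonneg _) (by positivity)
    have h2 : d * ↑(n * l) ≤ L.rate * L.cost * (2 * L.HB i * t) :=
      mul_le_mul hdle h1 (Nat.cast_nonneg _) (by positivity)
    have h3 : L.rate * k = L.rate * L.cost * (2 * L.HB i * t) + Real.log 2 * t := by
      rw [hkt, L.R_eq]
      field_simp
    linarith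
  have hmany : ((2 : ℝ)⁻¹) ^ l ≤ 2 * (2 : ℝ) ^ (-t) := by
    calc ((2 : ℝ)⁻¹) ^ l = (2 : ℝ) ^ (-(l : ℝ)) := by
          rw [Real.rpow_neg two_pos.le, Real.rpow_natCast, inv_pow]
      _ ≤ (2 : ℝ) ^ (1 + -t) :=
          Real.rpow_le_rpow_of_exponent_le one_le_two (by linarith)
      _ = 2 * (2 : ℝ) ^ (-t) := by rw [Real.rpow_add two_pos, Real.rpow_one]
  have hbound : C.μ i {f | (k : ℕ∞) < hit i f} ≤
      ENNReal.ofReal ((2 : ℝ)⁻¹ ^ l + Real.exp (d * ↑(n * l) - L.rate * k)) := by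
    refine (L.measure_lt_hit_le i hi hd hgrowth (n * l) k).trans ?_
    rw [ENNReal.ofReal_add (by positivity) (Real.exp_pos _).le]
    refine add_le_add ?_ (le_of_eq ?_)
    · refine (C.manyVisitsProb_mul_le i n
        (fun j hj => L.manyVisitsProb_floor_le hirr hi hj) l hi).trans (le_of_eq ?_)
      rw [ENNReal.ofReal_pow (by norm_num), ENNReal.ofReal_inv_of_pos two_pos,
        ENNReal.ofReal_ofNat]
    · rw [← ENNReal.ofReal_pow (Real.exp_pos _).le, ← ENNReal.ofReal_pow (Real.exp_pos _).le,
        ← ENNReal.ofReal_mul (by positivity), ← Real.exp_nat_mul, ← Real.exp_nat_mul,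
        ← Real.exp_add]
      congr 2
      ring
  have htail : C.tailP i k ≤ (2 : ℝ)⁻¹ ^ l + Real.exp (d * ↑(n * l) - L.rate * k) :=
    ENNReal.toReal_le_of_le_ofReal (by positivity) hbound
  have hexp := Real.exp_le_exp.2 hfew
  rw [← hpow] at hexp
  have h2 : 0 < (2 : ℝ) ^ (-t) := Real.rpow_pos_of_pos two_pos _
  rw [neg_div]
  linarith

end

end LocalStationary
end
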